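/- arXiv:2002.04481 — 8 statements merged into one kernel-verified Lean document; each statement's English description precedes it below -/
import Mathlib

section
/- Let U ∈ ℂ^{N_d×N_p} be a matrix with ℝ-orthonormal columns (i.e. Re(UᴴU) = Id_{N_p}), let R ∈ ℝ^{N_p×N_p} be an invertible real matrix, and set D = U·R ∈ ℂ^{N_d×N_p}. Let M ∈ ℂ^{N_d×N_m} be such that the real matrix Re(Uᴴ M Mᴴ U) is invertible. Then the real matrix Re(Dᴴ M Mᴴ D) = Rᵀ Re(Uᴴ M Mᴴ U) R is invertible and Tr[ D · (Re(Dᴴ M Mᴴ D))⁻¹ · Dᴴ ] = Tr[ (Re(Uᴴ M Mᴴ U))⁻¹ ]. -/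
open Matrix

/-- Entrywise real part of a complex matrix. -/
def Matrix.reParts {m n : Type*} (A : Matrix m n ℂ) : Matrix m n ℝ := A.map Complex.re

/-- Cast of a real matrix to a complex matrix. -/
def Matrix.toComplex {m n : Type*} (A : Matrix m n ℝ) : Matrix m n ℂ := A.map Complex.ofReal

namespace Matrix

variable {l m n : Type*}

theorem reParts_mul_toComplex [Fintype m] (A : Matrix l m ℂ) (B : Matrix m n ℝ) :
    (A * B.toComplex).reParts = A.reParts * B := by
  ext i j
  simp [reParts, toComplex, mul_apply]

theorem reParts_toComplex_mul [Fintype m] (A : Matrix l m ℝ) (B : Matrix m n ℂ) :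
    (A.toComplex * B).reParts = A * B.reParts := by
  ext i j
  simp [reParts, toComplex, mul_apply]

theorem toComplex_mul [Fintype m] (A : Matrix l m ℝ) (B : Matrix m n ℝ) :
    (A * B).toComplex = A.toComplex * B.toComplex := by
  ext i j
  simp [toComplex, mul_apply]

theorem conjTranspose_toComplex (A : Matrix m n ℝ) : A.toComplexᴴ = Aᵀ.toComplex := by
  ext i j
  simp [toComplex]

theorem IsHermitian.isSymm_reParts {A : Matrix n n ℂ} (hA : A.IsHermitian) :
    A.reParts.IsSymm := by
  ext i j
  simp [reParts, ← hA.apply i j]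

theorem re_trace [Fintype n] (A : Matrix n n ℂ) : A.trace.re = A.reParts.trace := by
  simp [trace, reParts]

/-- The imaginary part of a Hermitian matrix is antisymmetric, so it does not contribute to the
trace against a real symmetric matrix. -/
theorem trace_toComplex_mul_of_isSymm_of_isHermitian [Fintype n] {W : Matrix n n ℝ}
    {H : Matrix n n ℂ} (hW : W.IsSymm) (hH : H.IsHermitian) :
    (W.toComplex * H).trace = ((W * H.reParts).trace : ℂ) := by
  have hconj : star (W.toComplex * H).trace = (W.toComplex * H).trace := by
    rw [← trace_conjTranspose, conjTranspose_mul, conjTranspose_toComplex, hW.eq, hH.eq,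
      trace_mul_comm]
  rw [← reParts_toComplex_mul, ← re_trace]
  exact (Complex.conj_eq_iff_re.mp hconj).symm

end Matrix

/-- If `U` has ℝ-orthonormal columns, `R` is an invertible real matrix,
`D = U·R`, and `Re(Uᴴ M Mᴴ U)` is invertible, then `Re(Dᴴ M Mᴴ D) = Rᵀ Re(Uᴴ M Mᴴ U) R`
is invertible and `Tr[D (Re(Dᴴ M Mᴴ D))⁻¹ Dᴴ] = Tr[(Re(Uᴴ M Mᴴ U))⁻¹]`. -/
theorem crb_gram_schmidt_invariance {Nd Np Nm : ℕ}
    (U : Matrix (Fin Nd) (Fin Np) ℂ) (R : Matrix (Fin Np) (Fin Np) ℝ)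
    (M : Matrix (Fin Nd) (Fin Nm) ℂ) (D : Matrix (Fin Nd) (Fin Np) ℂ)
    (hU : (Uᴴ * U).reParts = 1)
    (hR : IsUnit R)
    (hD : D = U * R.toComplex)
    (hinv : IsUnit ((Uᴴ * M * Mᴴ * U).reParts)) :
    (Dᴴ * M * Mᴴ * D).reParts = Rᵀ * (Uᴴ * M * Mᴴ * U).reParts * R ∧
    IsUnit ((Dᴴ * M * Mᴴ * D).reParts) ∧
    (D * ((Dᴴ * M * Mᴴ * D).reParts)⁻¹.toComplex * Dᴴ).trace =
      ((((Uᴴ * M * Mᴴ * U).reParts)⁻¹).trace : ℂ) := by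
  set P := (Uᴴ * M * Mᴴ * U).reParts with hP
  have hherm : (Uᴴ * M * Mᴴ * U).IsHermitian := by
    simp [IsHermitian, Matrix.mul_assoc]
  have hPsymm : P⁻¹.IsSymm := by
    rw [IsSymm, transpose_nonsing_inv, hherm.isSymm_reParts.eq]
  have hgram : (Dᴴ * M * Mᴴ * D).reParts = Rᵀ * P * R := by
    rw [hP, ← reParts_toComplex_mul, ← reParts_mul_toComplex, hD, conjTranspose_mul,
      conjTranspose_toComplex]
    simp only [Matrix.mul_assoc]
  have hRt : IsUnit Rᵀ := (isUnit_transpose R).mpr hR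
  have hdet : IsUnit R.det := (isUnit_iff_isUnit_det R).mp hR
  have hdet_transpose : IsUnit Rᵀ.det := (isUnit_iff_isUnit_det Rᵀ).mp hRt
  have hcancel : R * (Rᵀ * P * R)⁻¹ * Rᵀ = P⁻¹ := by
    rw [Matrix.mul_inv_rev, Matrix.mul_inv_rev, mul_nonsing_inv_cancel_left _ _ hdet,
      nonsing_inv_mul_cancel_right _ _ hdet_transpose]
  refine ⟨hgram, hgram ▸ (hRt.mul hinv).mul hR, ?_⟩
  calc (D * ((Dᴴ * M * Mᴴ * D).reParts)⁻¹.toComplex * Dᴴ).trace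
      = (U * P⁻¹.toComplex * Uᴴ).trace := by
        rw [hgram, ← hcancel, toComplex_mul, toComplex_mul, hD, conjTranspose_mul,
          conjTranspose_toComplex]
        simp only [Matrix.mul_assoc]
    _ = (P⁻¹.toComplex * (Uᴴ * U)).trace := by
        rw [Matrix.mul_assoc, trace_mul_comm, Matrix.mul_assoc]
    _ = (P⁻¹.trace : ℂ) := by
        rw [trace_toComplex_mul_of_isSymm_of_isHermitian hPsymm
          (isHermitian_conjTranspose_mul_self U), hU, Matrix.mul_one]
end

section
/- Let E ⊆ ℂ^n be an ℝ-linear subspace of real dimension d (ℂ^n viewed as a real inner product space with inner product ⟨a,b⟩_ℝ = Re(aᴴb)). Then there exist vectors v_1, w_1, …, v_{⌊d/2⌋}, w_{⌊d/2⌋} ∈ E (plus one additional vector v_{⌊d/2⌋+1} ∈ E if d is odd) whose ℝ-linear span is E, together with real numbers c_1,…,c_{⌊d/2⌋} ∈ [0,1], such that v_mᴴv_n = δ_{mn}, w_mᴴw_n = δ_{mn}, v_mᴴw_n = −δ_{mn}·i·c_m for all m,n (and, if d is odd, v_{⌊d/2⌋+1} has unit norm and is ℂ-orthogonal to all v_m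 and w_m). In particular, E decomposes as a direct sum of mutually ℂ-orthogonal subspaces of real dimension 2 (and possibly one of real dimension 1 if d is odd). -/
open Matrix

section

open scoped InnerProductSpace

attribute [local instance] InnerProductSpace.complexToReal

variable {V : Type*} [NormedAddCommGroup V] [InnerProductSpace ℂ V]

theorem eq_zero_of_sq_add_sq_le_mul_sqrt {b c : ℝ}
    (h : c ^ 2 + b ^ 2 ≤ c * √(c ^ 2 + b ^ 2)) : b = 0 := by
  have hs := Real.sq_sqrt (show 0 ≤ c ^ 2 + b ^ 2 by positivity)
  have hn := Real.sqrt_nonneg (c ^ 2 + b ^ 2)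
  set r := √(c ^ 2 + b ^ 2)
  have hb : b ^ 2 ≤ 0 := by nlinarith [sq_nonneg (r - c)]
  exact (pow_eq_zero_iff two_ne_zero).1 (le_antisymm hb (sq_nonneg b))

/-- A real subspace of dimension at least two contains a real-orthonormal pair maximising the
imaginary part of the complex inner product. -/
theorem exists_orthonormal_pair_im_inner_max (E : Submodule ℝ V) [FiniteDimensional ℝ E]
    (hE : 2 ≤ Module.finrank ℝ E) :
    ∃ v ∈ E, ∃ w ∈ E, ‖v‖ = 1 ∧ ‖w‖ = 1 ∧ ⟪v, w⟫_ℝ = 0 ∧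
      ∀ x ∈ E, ∀ y ∈ E, ‖x‖ = 1 → ‖y‖ = 1 → ⟪x, y⟫_ℝ = 0 →
        (⟪x, y⟫_ℂ).im ≤ (⟪v, w⟫_ℂ).im := by
  let S : Set (E × E) :=
    (Metric.sphere 0 1 ×ˢ Metric.sphere 0 1) ∩ {p | ⟪(p.1 : V), (p.2 : V)⟫_ℝ = 0}
  have hS : IsCompact S :=
    ((isCompact_sphere _ _).prod (isCompact_sphere _ _)).inter_right
      (isClosed_eq (by fun_prop) continuous_const)
  have hne : S.Nonempty := by
    let e := stdOrthonormalBasis ℝ E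
    have h01 : (⟨0, by omega⟩ : Fin (Module.finrank ℝ E)) ≠ ⟨1, by omega⟩ := by simp
    exact ⟨(e ⟨0, by omega⟩, e ⟨1, by omega⟩), ⟨by simp, by simp⟩, e.orthonormal.2 h01⟩
  have hf : Continuous fun p : E × E => (⟪(p.1 : V), (p.2 : V)⟫_ℂ).im :=
    Complex.continuous_im.comp
      ((continuous_subtype_val.comp continuous_fst).inner
        (continuous_subtype_val.comp continuous_snd))
  obtain ⟨⟨v, w⟩, ⟨⟨hv, hw⟩, hvw⟩, hmax⟩ := hS.exists_isMaxOn hne hf.continuousOn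
  refine ⟨v, v.2, w, w.2, by simpa using hv, by simpa using hw, hvw, ?_⟩
  intro x hx y hy hx1 hy1 hxy
  exact hmax (a := (⟨x, hx⟩, ⟨y, hy⟩)) ⟨⟨by simpa using hx1, by simpa using hy1⟩, hxy⟩

/-- First-order optimality condition: if `w` maximises `x ↦ Im ⟪v, x⟫` among the unit vectors
of `E` real-orthogonal to `v`, then every vector of `E` real-orthogonal to `v` and `w` is
complex-orthogonal to `v`. -/
theorem complex_inner_eq_zero_of_im_inner_max {E : Submodule ℝ V} {v w u : V}
    (hw : w ∈ E) (hu : u ∈ E) (hw1 : ‖w‖ = 1) (hvw : ⟪v, w⟫_ℝ = 0) (hvu : ⟪v, u⟫_ℝ = 0)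
    (hwu : ⟪w, u⟫_ℝ = 0)
    (hmax : ∀ x ∈ E, ‖x‖ = 1 → ⟪v, x⟫_ℝ = 0 → (⟪v, x⟫_ℂ).im ≤ (⟪v, w⟫_ℂ).im) :
    ⟪v, u⟫_ℂ = 0 := by
  have him : ∀ (r : ℝ) (x : V), (⟪v, r • x⟫_ℂ).im = r * (⟪v, x⟫_ℂ).im := by
    intro r x
    rw [← Complex.coe_smul, inner_smul_right, Complex.im_ofReal_mul]
  have hbound : ∀ x ∈ E, ⟪v, x⟫_ℝ = 0 → (⟪v, x⟫_ℂ).im ≤ (⟪v, w⟫_ℂ).im * ‖x‖ := by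
    intro x hx hvx
    rcases eq_or_ne x 0 with rfl | hx0
    · simp
    have hpos : 0 < ‖x‖ := norm_pos_iff.2 hx0
    have h := hmax (‖x‖⁻¹ • x) (E.smul_mem _ hx)
      (by rw [norm_smul, norm_inv, norm_norm, inv_mul_cancel₀ hpos.ne'])
      (by rw [real_inner_smul_right, hvx, mul_zero])
    rwa [him, inv_mul_le_iff₀ hpos, mul_comm] at h
  apply Complex.ext hvu
  set b := (⟪v, u⟫_ℂ).im
  set c := (⟪v, w⟫_ℂ).im
  have h := hbound ((c * ‖u‖ ^ 2) • w + b • u) (E.add_mem (E.smul_mem _ hw) (E.smul_mem _ hu))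
    (by rw [inner_add_right, real_inner_smul_right, real_inner_smul_right, hvw, hvu]; simp)
  have hnorm : ‖(c * ‖u‖ ^ 2) • w + b • u‖ = ‖u‖ * √((c * ‖u‖) ^ 2 + b ^ 2) := by
    rw [← Real.sqrt_sq (norm_nonneg u), ← Real.sqrt_mul (sq_nonneg _),
      Real.sqrt_sq (norm_nonneg u), ← Real.sqrt_sq (norm_nonneg (_ + _)),
      norm_add_sq_real, real_inner_smul_left, real_inner_smul_right, hwu, norm_smul, norm_smul,
      hw1]
    congr 1
    simp only [mul_pow, Real.norm_eq_abs, sq_abs]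
    ring
  rw [inner_add_right, Complex.add_im, him, him, hnorm] at h
  refine eq_zero_of_sq_add_sq_le_mul_sqrt (c := c * ‖u‖) ?_
  linarith

/-- A real subspace `E` of dimension at least two contains a plane whose real-orthogonal
complement in `E` is complex-orthogonal to it. -/
theorem exists_pair_complex_orthogonal_complement (E : Submodule ℝ V) [FiniteDimensional ℝ E]
    (hE : 2 ≤ Module.finrank ℝ E) :
    ∃ v ∈ E, ∃ w ∈ E, ∃ c : ℝ, 0 ≤ c ∧ c ≤ 1 ∧ ‖v‖ = 1 ∧ ‖w‖ = 1 ∧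
      ⟪v, w⟫_ℂ = -(Complex.I * c) ∧
      ∀ u ∈ E, ⟪v, u⟫_ℝ = 0 → ⟪w, u⟫_ℝ = 0 → ⟪v, u⟫_ℂ = 0 ∧ ⟪w, u⟫_ℂ = 0 := by
  obtain ⟨w, hw, v, hv, hw1, hv1, hwv, hmax⟩ := exists_orthonormal_pair_im_inner_max E hE
  have hvw : ⟪v, w⟫_ℝ = 0 := by rw [real_inner_comm, hwv]
  have him : ∀ x y : V, (⟪x, y⟫_ℂ).im = -(⟪y, x⟫_ℂ).im := fun x y => by
    rw [← inner_conj_symm, Complex.conj_im]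
  refine ⟨v, hv, w, hw, (⟪w, v⟫_ℂ).im, ?_, ?_, hv1, hw1, ?_, ?_⟩
  · have h := hmax v hv w hw hv1 hw1 hvw
    rw [him] at h
    linarith
  · calc (⟪w, v⟫_ℂ).im ≤ ‖⟪w, v⟫_ℂ‖ := (le_abs_self _).trans (Complex.abs_im_le_norm _)
      _ ≤ ‖w‖ * ‖v‖ := norm_inner_le_norm _ _
      _ = 1 := by rw [hw1, hv1, mul_one]
  · apply Complex.ext
    · simpa using (show (⟪v, w⟫_ℂ).re = 0 from hvw)
    · simpa using him v w
  · intro u hu hvu hwu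
    refine ⟨?_, complex_inner_eq_zero_of_im_inner_max hv hu hv1 hwv hwu hvu
      fun x hx hx1 hwx => hmax w hw x hx hw1 hx1 hwx⟩
    refine complex_inner_eq_zero_of_im_inner_max (w := -w) (E.neg_mem hw) hu (by simpa using hw1)
      (by simpa using hvw) hvu (by simpa using hwu) fun x hx hx1 hvx => ?_
    have h := hmax (-x) (E.neg_mem hx) v hv (by simpa using hx1) hv1
      (by rw [inner_neg_left, real_inner_comm, hvx, neg_zero])
    rw [inner_neg_left, Complex.neg_im, ← him] at h
    rwa [inner_neg_right, Complex.neg_im, ← him]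

theorem exists_complex_orthogonal_decomposition (k e : ℕ) (he : e ≤ 1) (E : Submodule ℝ V)
    [FiniteDimensional ℝ E] (hE : Module.finrank ℝ E = 2 * k + e) :
    ∃ (v w : ℕ → V) (c : ℕ → ℝ), (∀ a < k + e, v a ∈ E) ∧ (∀ a < k, w a ∈ E) ∧
      E ≤ Submodule.span ℝ (v '' Set.Iio (k + e) ∪ w '' Set.Iio k) ∧
      (∀ a < k, 0 ≤ c a ∧ c a ≤ 1) ∧
      (∀ a < k + e, ∀ b < k + e, ⟪v a, v b⟫_ℂ = if a = b then 1 else 0) ∧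
      (∀ a < k, ∀ b < k, ⟪w a, w b⟫_ℂ = if a = b then 1 else 0) ∧
      (∀ a < k + e, ∀ b < k, ⟪v a, w b⟫_ℂ = if a = b then -(Complex.I * c b) else 0) := by
  induction k generalizing E with
  | zero =>
    interval_cases e
    · have : E = ⊥ := Submodule.finrank_eq_zero.1 hE
      exact ⟨0, 0, 0, by simp [this]⟩
    · obtain ⟨u, hu⟩ : ∃ u : E, ‖u‖ = 1 := by
        have : Nontrivial E := Module.nontrivial_of_finrank_pos (R := ℝ) (by omega)
        exact exists_norm_eq E zero_le_one
      have hu0 : u ≠ 0 := by rintro rfl; simp at hu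
      have hu' : ‖(u : V)‖ = 1 := hu
      refine ⟨fun _ => u, 0, 0, by simp, by simp, ?_, by simp, ?_, by simp, by simp⟩
      · intro x hx
        obtain ⟨r, hr⟩ := exists_smul_eq_of_finrank_eq_one hE hu0 ⟨x, hx⟩
        rw [show x = r • (u : V) from congrArg Subtype.val hr.symm]
        exact Submodule.smul_mem _ _ (Submodule.subset_span (Or.inl ⟨0, by simp, rfl⟩))
      · intro a ha b hb
        rw [if_pos (by omega), inner_self_eq_norm_sq_to_K, hu']
        simp
  | succ k ih =>
    obtain ⟨v₀, hv₀, w₀, hw₀, c₀, hc0, hc1, hv1, hw1, hvw, horth⟩ :=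
      exists_pair_complex_orthogonal_complement E (by omega)
    have hre : ⟪v₀, w₀⟫_ℝ = 0 := by
      change (⟪v₀, w₀⟫_ℂ).re = 0
      simp [hvw]
    let P : Submodule ℝ V := Submodule.span ℝ {v₀, w₀}
    have hPE : P ≤ E := Submodule.span_le.2 (by rintro x (rfl | rfl) <;> assumption)
    have hP : Module.finrank ℝ P = 2 := by
      have hon : Orthonormal ℝ ![v₀, w₀] := by
        rw [orthonormal_vecCons_iff]
        simp [hv1, hre, hw1]
      have h := finrank_span_eq_card hon.linearIndependent
      rwa [Matrix.range_cons_cons_empty, Fintype.card_fin] at h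
    have hdim := Submodule.finrank_add_inf_finrank_orthogonal hPE
    have : FiniteDimensional ℝ (Pᗮ ⊓ E : Submodule ℝ V) :=
      Submodule.finiteDimensional_of_le inf_le_right
    have : FiniteDimensional ℝ P := Submodule.finiteDimensional_of_le hPE
    have hvP : v₀ ∈ P := Submodule.subset_span (by simp)
    have hwP : w₀ ∈ P := Submodule.subset_span (by simp)
    obtain ⟨v, w, c, hv, hw, hspan, hc, hvv, hww, hvw'⟩ := ih (Pᗮ ⊓ E) (by omega)
    have hzero : ∀ u ∈ Pᗮ ⊓ E, ⟪v₀, u⟫_ℂ = 0 ∧ ⟪w₀, u⟫_ℂ = 0 := fun u hu =>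
      horth u hu.2 (hu.1 v₀ hvP) (hu.1 w₀ hwP)
    have hzero' : ∀ u ∈ Pᗮ ⊓ E, ⟪u, v₀⟫_ℂ = 0 ∧ ⟪u, w₀⟫_ℂ = 0 := fun u hu =>
      ⟨inner_eq_zero_symm.1 (hzero u hu).1, inner_eq_zero_symm.1 (hzero u hu).2⟩
    have hunit : ∀ x : V, ‖x‖ = 1 → ⟪x, x⟫_ℂ = 1 := fun x hx => by
      rw [inner_self_eq_norm_sq_to_K, hx]
      simp
    refine ⟨fun a => a.casesOn v₀ v, fun a => a.casesOn w₀ w, fun a => a.casesOn c₀ c,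
      ?_, ?_, ?_, ?_, ?_, ?_, ?_⟩
    · rintro (_ | a) ha
      exacts [hv₀, (hv a (by omega)).2]
    · rintro (_ | a) ha
      exacts [hw₀, (hw a (by omega)).2]
    · rw [← Submodule.sup_orthogonal_inf_of_hasOrthogonalProjection hPE]
      refine sup_le (Submodule.span_mono ?_) (hspan.trans (Submodule.span_mono ?_))
      · rintro x (rfl | rfl)
        exacts [Or.inl ⟨0, by simp, rfl⟩, Or.inr ⟨0, by simp, rfl⟩]
      · rintro x (⟨a, ha, rfl⟩ | ⟨a, ha, rfl⟩) <;> rw [Set.mem_Iio] at ha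
        exacts [Or.inl ⟨a + 1, by simp; omega, rfl⟩, Or.inr ⟨a + 1, by simp; omega, rfl⟩]
    · rintro (_ | a) ha
      exacts [⟨hc0, hc1⟩, hc a (by omega)]
    · rintro (_ | a) ha (_ | b) hb
      · simpa using hunit v₀ hv1
      · simpa using (hzero _ (hv b (by omega))).1
      · simpa using (hzero' _ (hv a (by omega))).1
      · simpa using hvv a (by omega) b (by omega)
    · rintro (_ | a) ha (_ | b) hb
      · simpa using hunit w₀ hw1
      · simpa using (hzero _ (hw b (by omega))).2
      · simpa using (hzero' _ (hw a (by omega))).2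
      · simpa using hww a (by omega) b (by omega)
    · rintro (_ | a) ha (_ | b) hb
      · simpa using hvw
      · simpa using (hzero _ (hw b (by omega))).1
      · simpa using (hzero' _ (hv a (by omega))).2
      · simpa using hvw' a (by omega) b (by omega)

end

/-- Lemma 1(i) of the paper. Any ℝ-linear subspace `E ⊆ ℂ^n` of real
dimension `d` admits a spanning family `v_1, w_1, …, v_{⌊d/2⌋}, w_{⌊d/2⌋}` (plus an extra
unit vector `v_{⌊d/2⌋+1}` if `d` is odd, ℂ-orthogonal to all the others) and scalars
`c_k ∈ [0,1]` with `v_mᴴv_n = δ_{mn}`, `w_mᴴw_n = δ_{mn}`, `v_mᴴw_n = −δ_{mn}·i·c_m`.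
In particular `E` is the direct sum of mutually ℂ-orthogonal subspaces of real dimension 2
(plus possibly one of real dimension 1 if `d` is odd). -/
theorem real_subspace_complex_orthogonal_decomposition {n d : ℕ}
    (E : Submodule ℝ (Fin n → ℂ))
    (hdim : Module.finrank ℝ E = d) :
    ∃ (v : Fin (d / 2 + d % 2) → (Fin n → ℂ)) (w : Fin (d / 2) → (Fin n → ℂ))
      (c : Fin (d / 2) → ℝ),
      (∀ a, v a ∈ E) ∧ (∀ k, w k ∈ E) ∧
      Submodule.span ℝ (Set.range v ∪ Set.range w) = E ∧
      (∀ k, 0 ≤ c k ∧ c k ≤ 1) ∧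
      (∀ a b, star (v a) ⬝ᵥ v b = if a = b then 1 else 0) ∧
      (∀ k l, star (w k) ⬝ᵥ w l = if k = l then 1 else 0) ∧
      (∀ (a : Fin (d / 2 + d % 2)) (k : Fin (d / 2)),
        star (v a) ⬝ᵥ w k = if (a : ℕ) = (k : ℕ) then -(Complex.I * (c k : ℂ)) else 0) := by
  let L : (Fin n → ℂ) ≃ₗ[ℝ] EuclideanSpace ℂ (Fin n) :=
    (WithLp.linearEquiv 2 ℂ (Fin n → ℂ)).symm.restrictScalars ℝ
  have hL : ∀ x y : EuclideanSpace ℂ (Fin n),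
      star (L.symm x) ⬝ᵥ L.symm y = inner ℂ x y := fun x y => by
    rw [EuclideanSpace.inner_eq_star_dotProduct, dotProduct_comm]
    rfl
  have hmem : ∀ x ∈ E.map L.toLinearMap, L.symm x ∈ E := by
    rintro _ ⟨x, hx, rfl⟩
    simpa using hx
  obtain ⟨v, w, c, hv, hw, hspan, hc, hvv, hww, hvw⟩ :=
    exists_complex_orthogonal_decomposition (d / 2) (d % 2) (by omega) (E.map L.toLinearMap)
      (by rw [LinearEquiv.finrank_map_eq, hdim]; omega)
  refine ⟨fun a => L.symm (v a), fun a => L.symm (w a), fun a => c a,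
    fun a => hmem _ (hv a a.2), fun a => hmem _ (hw a a.2), le_antisymm ?_ ?_,
    fun a => hc a a.2, fun a b => ?_, fun a b => ?_, fun a b => ?_⟩
  · rw [Submodule.span_le]
    rintro _ (⟨a, rfl⟩ | ⟨a, rfl⟩)
    exacts [hmem _ (hv a a.2), hmem _ (hw a a.2)]
  · intro x hx
    have h := Submodule.mem_map_of_mem (f := L.symm.toLinearMap)
      (hspan (Submodule.mem_map_of_mem (f := L.toLinearMap) hx))
    rw [Submodule.map_span] at h
    have hx' : L.symm.toLinearMap (L.toLinearMap x) = x := L.symm_apply_apply x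
    rw [hx'] at h
    refine Submodule.span_mono ?_ h
    rintro _ ⟨_, ⟨a, ha, rfl⟩ | ⟨a, ha, rfl⟩, rfl⟩
    exacts [Or.inl ⟨⟨a, ha⟩, rfl⟩, Or.inr ⟨⟨a, ha⟩, rfl⟩]
  · rw [hL, hvv a a.2 b b.2]
    simp only [Fin.ext_iff]
  · rw [hL, hww a a.2 b b.2]
    simp only [Fin.ext_iff]
  · rw [hL, hvw a a.2 b b.2]
end

section
/- Let U ∈ ℂ^{n×p} be a matrix with ℝ-orthonormal columns (i.e. Re(UᴴU) = Id_p). Then there exist a real orthogonal matrix B ∈ ℝ^{p×p} (BᵀB = Id_p) and real numbers c_1,…,c_{⌊p/2⌋} ∈ [0,1] such that Bᵀ·Im(UᴴU)·B is block-diagonal with ⌊p/2⌋ diagonal blocks of the form [[0, −c_k],[c_k, 0]] (and, if p is odd, a final 1×1 zero block). -/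
open Matrix

/-- A skew-symmetric operator on a real inner product space of dimension at least two acts on some
orthonormal pair as a nonnegative multiple of a quarter turn. -/
lemma exists_orthonormal_pair_of_skew {E : Type*} [NormedAddCommGroup E] [InnerProductSpace ℝ E]
    [FiniteDimensional ℝ E] (T : E →ₗ[ℝ] E) (hT : ∀ x y, inner ℝ (T x) y = -inner ℝ x (T y))
    (hE : 2 ≤ Module.finrank ℝ E) :
    ∃ (u v : E) (c : ℝ), 0 ≤ c ∧ ‖u‖ = 1 ∧ ‖v‖ = 1 ∧ inner ℝ u v = 0 ∧
      T u = c • v ∧ T v = -(c • u) := by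
  have hS : (T ∘ₗ T).IsSymmetric := fun x y => by
    simp only [LinearMap.comp_apply, hT, neg_neg]
  set b := hS.eigenvectorBasis rfl
  by_cases h0 : ∀ i, T (b i) = 0
  · refine ⟨b ⟨0, by omega⟩, b ⟨1, by omega⟩, 0, le_rfl, b.orthonormal.1 _, b.orthonormal.1 _,
      b.orthonormal.2 (by simp), by simp [h0], by simp [h0]⟩
  · push Not at h0
    obtain ⟨i, hi⟩ := h0
    have hc : ‖T (b i)‖ ≠ 0 := norm_ne_zero_iff.2 hi
    have h1 : ‖b i‖ = 1 := b.orthonormal.1 i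
    have hSi : T (T (b i)) = hS.eigenvalues rfl i • b i := hS.apply_eigenvectorBasis rfl i
    have hμ : hS.eigenvalues rfl i = -‖T (b i)‖ ^ 2 := by
      have h2 := hT (T (b i)) (b i)
      rwa [hSi, real_inner_smul_left, real_inner_self_eq_norm_sq, real_inner_self_eq_norm_sq, h1,
        one_pow, mul_one] at h2
    have horth : inner ℝ (b i) (T (b i)) = 0 := by
      have h2 := hT (b i) (b i)
      rw [real_inner_comm] at h2
      linarith
    refine ⟨b i, ‖T (b i)‖⁻¹ • T (b i), ‖T (b i)‖, norm_nonneg _, h1, ?_, ?_, ?_, ?_⟩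
    · rw [norm_smul, norm_inv, norm_norm, inv_mul_cancel₀ hc]
    · rw [real_inner_smul_right, horth, mul_zero]
    · rw [smul_smul, mul_inv_cancel₀ hc, one_smul]
    · rw [map_smul, hSi, hμ, smul_smul, ← neg_smul]
      congr 1
      field_simp

/-- **Youla normal form** of a skew-symmetric operator on a real inner product space. -/
theorem exists_orthonormal_skew_normal_form (p : ℕ) {E : Type*} [NormedAddCommGroup E]
    [InnerProductSpace ℝ E] [FiniteDimensional ℝ E] (T : E →ₗ[ℝ] E)
    (hT : ∀ x y, inner ℝ (T x) y = -inner ℝ x (T y)) (hE : Module.finrank ℝ E = p) :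
    ∃ (b : Fin p → E) (c : ℕ → ℝ), Orthonormal ℝ b ∧ (∀ k, 0 ≤ c k) ∧
      ∀ i j : Fin p, inner ℝ (b i) (T (b j)) =
        if (i : ℕ) / 2 = (j : ℕ) / 2 then
          (if (i : ℕ) % 2 = 0 ∧ (j : ℕ) % 2 = 1 then -c ((i : ℕ) / 2)
           else if (i : ℕ) % 2 = 1 ∧ (j : ℕ) % 2 = 0 then c ((i : ℕ) / 2)
           else 0)
        else 0 := by
  induction p using Nat.strong_induction_on generalizing E with
  | _ p ih =>
  match p, hE, ih with
  | 0, _, _ => exact ⟨Fin.elim0, 0, ⟨fun i => i.elim0, fun i => i.elim0⟩, fun _ => le_rfl,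
      fun i => i.elim0⟩
  | 1, hE, _ =>
    let b := stdOrthonormalBasis ℝ E
    refine ⟨fun i => b (Fin.cast hE.symm i), 0, b.orthonormal.comp _ (Fin.cast_injective _),
      fun _ => le_rfl, fun i j => ?_⟩
    obtain rfl := Subsingleton.elim i j
    have h2 := hT (b (Fin.cast hE.symm i)) (b (Fin.cast hE.symm i))
    rw [real_inner_comm] at h2
    simp
    linarith
  | m + 2, hE, ih =>
    obtain ⟨u, v, a, ha, hu, hv, huv, hTu, hTv⟩ := exists_orthonormal_pair_of_skew T hT (by omega)
    have huv' : Orthonormal ℝ ![u, v] := by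
      simp [orthonormal_vecCons_iff, hu, hv, huv]
    let W : Submodule ℝ E := Submodule.span ℝ (Set.range ![u, v])
    have hW : Module.finrank ℝ W = 2 := by
      simpa using finrank_span_eq_card huv'.linearIndependent
    have hWp : Module.finrank ℝ Wᗮ = m := by
      have := W.finrank_add_finrank_orthogonal
      omega
    have hmem : ∀ x, x ∈ Wᗮ ↔ inner ℝ u x = 0 ∧ inner ℝ v x = 0 := fun x => by
      simp only [W, Matrix.range_cons, Matrix.range_empty, Set.union_empty, Submodule.span_union,
        ← Submodule.inf_orthogonal, Submodule.mem_inf,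
        Submodule.mem_orthogonal_singleton_iff_inner_right]
    have hinv : ∀ x ∈ Wᗮ, T x ∈ Wᗮ := fun x hx => by
      rw [hmem] at hx ⊢
      have h1 := hT u x
      have h2 := hT v x
      simp only [hTu, hTv, real_inner_smul_left, inner_neg_left, hx.1, hx.2, mul_zero] at h1 h2
      constructor <;> linarith
    obtain ⟨b, c, hb, hc, hbc⟩ := ih m (by omega) (T.restrict hinv)
      (fun x y => hT x y) hWp
    have hub : ∀ i, inner ℝ u (b i : E) = 0 := fun i => ((hmem _).1 (b i).2).1
    have hvb : ∀ i, inner ℝ v (b i : E) = 0 := fun i => ((hmem _).1 (b i).2).2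
    have huTb : ∀ i, inner ℝ u (T (b i : E)) = 0 := fun i => ((hmem _).1 (hinv _ (b i).2)).1
    have hvTb : ∀ i, inner ℝ v (T (b i : E)) = 0 := fun i => ((hmem _).1 (hinv _ (b i).2)).2
    have hb' : Orthonormal ℝ (fun i => (b i : E)) := hb.comp_linearIsometry Wᗮ.subtypeₗᵢ
    refine ⟨vecCons u (vecCons v fun i => (b i : E)), fun k => Nat.casesOn k a c, ?_, ?_, ?_⟩
    · rw [orthonormal_vecCons_iff, orthonormal_vecCons_iff]
      refine ⟨hu, fun i => ?_, hv, hvb, hb'⟩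
      refine Fin.cases huv (fun i => ?_) i
      exact hub i
    · rintro (_ | k)
      exacts [ha, hc k]
    · have hbu : ∀ i, inner ℝ (b i : E) u = 0 := fun i => by rw [real_inner_comm, hub]
      have hbv : ∀ i, inner ℝ (b i : E) v = 0 := fun i => by rw [real_inner_comm, hvb]
      have hvu : inner ℝ v u = 0 := by rw [real_inner_comm, huv]
      have huu : inner ℝ u u = 1 := by rw [real_inner_self_eq_norm_sq, hu, one_pow]
      have hvv : inner ℝ v v = 1 := by rw [real_inner_self_eq_norm_sq, hv, one_pow]
      have hdiv : ∀ k : ℕ, (k + 1 + 1) / 2 = k / 2 + 1 := fun k => by omega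
      have hmod : ∀ k : ℕ, (k + 1 + 1) % 2 = k % 2 := fun k => by omega
      intro i j
      refine Fin.cases ?_ (fun i => Fin.cases ?_ (fun i => ?_) i) i <;>
      refine Fin.cases ?_ (fun j => Fin.cases ?_ (fun j => ?_) j) j
      all_goals
        simp only [cons_val_zero, cons_val_succ, hTu, hTv, inner_neg_right, real_inner_smul_right,
          huv, hvu, huu, hvv, hbu, hbv, huTb, hvTb, Fin.val_zero, Fin.val_succ, hdiv, hmod]
      all_goals first
        | (simp; done)
        | skip
      simpa using hbc i j

/-- The imaginary part of a Gram matrix whose real part is the identity takes values at least `-1`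
on pairs of real unit vectors. -/
lemma neg_one_le_dotProduct_gram_im {m n : Type*} [Fintype m] [Fintype n] [DecidableEq n]
    (U : Matrix m n ℂ) (hU : (Uᴴ * U).map Complex.re = 1) (u v : n → ℝ)
    (hu : u ⬝ᵥ u = 1) (hv : v ⬝ᵥ v = 1) :
    -1 ≤ u ⬝ᵥ ((Uᴴ * U).map Complex.im *ᵥ v) := by
  set A := U.map Complex.re
  set C := U.map Complex.im
  have hre : (Uᴴ * U).map Complex.re = Aᵀ * A + Cᵀ * C := by
    ext i j
    simp [A, C, Matrix.mul_apply, Finset.sum_add_distrib]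
  have him : (Uᴴ * U).map Complex.im = Aᵀ * C - Cᵀ * A := by
    ext i j
    simp [A, C, Matrix.mul_apply, Finset.sum_add_distrib, sub_eq_add_neg]
  have hpull : ∀ (X Y : Matrix m n ℝ) (x y : n → ℝ),
      x ⬝ᵥ ((Xᵀ * Y) *ᵥ y) = (X *ᵥ x) ⬝ᵥ (Y *ᵥ y) := fun X Y x y => by
    rw [← mulVec_mulVec, dotProduct_mulVec, vecMul_transpose]
  have hone : ∀ x : n → ℝ, (A *ᵥ x) ⬝ᵥ (A *ᵥ x) + (C *ᵥ x) ⬝ᵥ (C *ᵥ x) = x ⬝ᵥ x := fun x => by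
    rw [← hpull, ← hpull, ← dotProduct_add, ← add_mulVec, ← hre, hU, one_mulVec]
  have h1 : 0 ≤ (A *ᵥ u + C *ᵥ v) ⬝ᵥ (A *ᵥ u + C *ᵥ v) :=
    Finset.sum_nonneg fun _ _ => mul_self_nonneg _
  have h2 : 0 ≤ (C *ᵥ u - A *ᵥ v) ⬝ᵥ (C *ᵥ u - A *ᵥ v) :=
    Finset.sum_nonneg fun _ _ => mul_self_nonneg _
  have h3 := hone u
  have h4 := hone v
  rw [him, sub_mulVec, dotProduct_sub, hpull, hpull]
  simp only [add_dotProduct, dotProduct_add, sub_dotProduct, dotProduct_sub,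
    dotProduct_comm (C *ᵥ v) (A *ᵥ u), dotProduct_comm (A *ᵥ v) (C *ᵥ u)] at h1 h2
  linarith

/-- equation (14) of the paper. If `U ∈ ℂ^{n×p}` has ℝ-orthonormal
columns, then there exist a real orthogonal `B ∈ ℝ^{p×p}` and scalars
`c_1,…,c_{⌊p/2⌋} ∈ [0,1]` such that `Bᵀ·Im(UᴴU)·B` is block diagonal with `⌊p/2⌋`
blocks `[[0, −c_k],[c_k, 0]]` (and a final `1×1` zero block if `p` is odd). -/
theorem skew_part_real_normal_form {n p : ℕ}
    (U : Matrix (Fin n) (Fin p) ℂ)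
    (hU : (Uᴴ * U).map Complex.re = 1) :
    ∃ (B : Matrix (Fin p) (Fin p) ℝ) (c : Fin (p / 2) → ℝ),
      Bᵀ * B = 1 ∧
      (∀ k, 0 ≤ c k ∧ c k ≤ 1) ∧
      (∀ i j : Fin p, (Bᵀ * (Uᴴ * U).map Complex.im * B) i j =
        if h : (i : ℕ) / 2 = (j : ℕ) / 2 ∧ (i : ℕ) / 2 < p / 2 then
          (if (i : ℕ) % 2 = 0 ∧ (j : ℕ) % 2 = 1 then -c ⟨(i : ℕ) / 2, h.2⟩
           else if (i : ℕ) % 2 = 1 ∧ (j : ℕ) % 2 = 0 then c ⟨(i : ℕ) / 2, h.2⟩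
           else 0)
        else 0) := by
  set M := (Uᴴ * U).map Complex.im with hM
  have hMT : Mᵀ = -M := by
    ext i j
    have h := congrFun₂ (isHermitian_conjTranspose_mul_self U) i j
    have h' := congrArg Complex.im h
    simp only [conjTranspose_apply, Complex.star_def, Complex.conj_im] at h'
    simp only [hM, transpose_apply, map_apply, Matrix.neg_apply]
    linarith
  have hinner : ∀ x y : EuclideanSpace ℝ (Fin p),
      inner ℝ x y = x.ofLp ⬝ᵥ y.ofLp := fun x y => by
    simp [EuclideanSpace.inner_eq_star_dotProduct, dotProduct_comm]
  have hT : ∀ x y : EuclideanSpace ℝ (Fin p),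
      inner ℝ (toEuclideanLin M x) y = -inner ℝ x (toEuclideanLin M y) := fun x y => by
    simp only [hinner, ofLp_toLpLin, toLin'_apply]
    rw [dotProduct_mulVec, ← mulVec_transpose, hMT, neg_mulVec, neg_dotProduct, neg_neg]
  obtain ⟨b, c, hb, hc, hbc⟩ :=
    exists_orthonormal_skew_normal_form p (toEuclideanLin M) hT (by simp)
  have hbb : ∀ i j, (b i).ofLp ⬝ᵥ (b j).ofLp = if i = j then 1 else 0 := fun i j => by
    rw [← hinner, orthonormal_iff_ite.1 hb]
  refine ⟨of fun i j => b j i, fun k => c k, ?_, fun k => ⟨hc k, ?_⟩, fun i j => ?_⟩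
  · ext i j
    rw [one_apply, ← hbb]
    rfl
  · have h := hbc ⟨2 * k, by omega⟩ ⟨2 * k + 1, by omega⟩
    have h1 := neg_one_le_dotProduct_gram_im U hU (b ⟨2 * k, by omega⟩).ofLp
      (b ⟨2 * k + 1, by omega⟩).ofLp (by simp [hbb]) (by simp [hbb])
    rw [hinner, ofLp_toLpLin, toLin'_apply, if_pos (by simp; omega),
      if_pos (by constructor <;> simp)] at h
    have hk : 2 * (k : ℕ) / 2 = k := by omega
    simp only [hk] at h
    linarith
  · have h := hbc i j
    rw [hinner, ofLp_toLpLin, toLin'_apply] at h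
    have hentry : ((of fun i j => b j i)ᵀ * M * (of fun i j => b j i) :
        Matrix (Fin p) (Fin p) ℝ) i j = (b i).ofLp ⬝ᵥ (M *ᵥ (b j).ofLp) := by
      rw [Matrix.mul_assoc]
      rfl
    rw [hentry, h]
    split_ifs <;> first | rfl | omega
end

section
/- Let E ⊆ ℂ^n be a finite-dimensional ℝ-linear subspace (ℂ^n viewed as a real inner product space with inner product ⟨a,b⟩_ℝ = Re(aᴴb)). Suppose v₁, w₁ ∈ E are unit vectors achieving the maximum c₁ = max{⟨v, i·w⟩_ℝ : v,w ∈ E, ‖v‖=‖w‖=1}, and suppose c₁ > 0. Then: (a) ⟨v₁, w₁⟩_ℝ = 0 (v₁ and w₁ are ℝ-orthogonal); and (b) every z ∈ E with ⟨z, v₁⟩_ℝ = 0 and ⟨z, w₁⟩_ℝ = 0 satisfies zᴴv₁ = 0 and zᴴw₁ = 0 (z is ℂ-orthogonal to both v₁ and w₁). -/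
open Matrix

-- Note: `EuclideanSpace ℂ (Fin n)` carries the real inner product structure
-- `⟪a,b⟫_ℝ = Re(aᴴb)` (restriction of scalars of the standard complex inner product).

/-- A nonnegative maximum of `⟪·, a⟫` over the unit vectors of a subspace `S`, attained at `x`,
forces the restriction of `⟪·, a⟫` to `S` to be `⟪x, a⟫ ⟪·, x⟫`. -/
theorem inner_eq_mul_inner_of_forall_unit_inner_le {F : Type*} [NormedAddCommGroup F]
    [InnerProductSpace ℝ F] (S : Submodule ℝ F) {x a : F} (hx : x ∈ S) (hxn : ‖x‖ = 1)
    (h0 : 0 ≤ inner ℝ x a) (hmax : ∀ y ∈ S, ‖y‖ = 1 → inner ℝ y a ≤ inner ℝ x a)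
    {y : F} (hy : y ∈ S) : inner ℝ y a = inner ℝ x a * inner ℝ y x := by
  have hbound : ∀ u ∈ S, inner ℝ u a ≤ inner ℝ x a * ‖u‖ := by
    intro u hu
    rcases eq_or_ne u 0 with rfl | hne
    · simp
    · have h := hmax (‖u‖⁻¹ • u) (S.smul_mem _ hu) (norm_smul_inv_norm (𝕜 := ℝ) hne)
      rwa [real_inner_smul_left, inv_mul_le_iff₀ (norm_pos_iff.2 hne), mul_comm] at h
  have hquad : ∀ t : ℝ, t * (inner ℝ y a - inner ℝ x a * inner ℝ y x) ≤
      t ^ 2 * (inner ℝ x a * ‖y‖ ^ 2 / 2) := by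
    intro t
    have h := hbound (x + t • y) (S.add_mem hx (S.smul_mem t hy))
    have hn : ‖x + t • y‖ ^ 2 = 1 + 2 * (t * inner ℝ y x) + t ^ 2 * ‖y‖ ^ 2 := by
      rw [norm_add_sq_real, hxn, real_inner_smul_right, real_inner_comm, norm_smul, mul_pow,
        Real.norm_eq_abs, sq_abs]
      ring
    rw [inner_add_left, real_inner_smul_left] at h
    nlinarith [mul_nonneg h0 (sq_nonneg (‖x + t • y‖ - 1))]
  set d := inner ℝ y a - inner ℝ x a * inner ℝ y x with hd
  set K := inner ℝ x a * ‖y‖ ^ 2 / 2 with hK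
  have hK0 : 0 ≤ K := by positivity
  have h := hquad (d / (K + 1))
  have hd0 : d ^ 2 ≤ 0 := by
    rw [div_pow, div_mul_eq_mul_div, div_mul_eq_mul_div, div_le_div_iff₀ (by positivity)
      (by positivity)] at h
    have hp : 0 < K + 1 := by positivity
    have : (K + 1) * d ^ 2 ≤ 0 := by
      have h' : (K + 1) * ((K + 1) * d ^ 2) ≤ (K + 1) * (K * d ^ 2) := by linarith
      have := le_of_mul_le_mul_left h' hp
      nlinarith
    exact nonpos_of_mul_nonpos_right this hp
  have : d = 0 := pow_eq_zero_iff two_ne_zero |>.1 (le_antisymm hd0 (sq_nonneg d))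
  linarith

theorem EuclideanSpace.real_inner_eq_re_inner {ι : Type*} [Fintype ι] (x y : EuclideanSpace ℂ ι) :
    inner ℝ x y = (inner ℂ x y).re := by
  simp [PiLp.inner_apply, Complex.inner]

theorem EuclideanSpace.real_inner_I_smul_right {ι : Type*} [Fintype ι]
    (x y : EuclideanSpace ℂ ι) : inner ℝ x (Complex.I • y) = -(inner ℂ x y).im := by
  simp [real_inner_eq_re_inner]

theorem EuclideanSpace.real_inner_I_smul_swap {ι : Type*} [Fintype ι]
    (x y : EuclideanSpace ℂ ι) :
    inner ℝ x (-(Complex.I • y)) = inner ℝ y (Complex.I • x) := by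
  rw [inner_neg_right, real_inner_I_smul_right, real_inner_I_smul_right,
    ← inner_conj_symm x y, Complex.conj_im, neg_neg]

/-- first-order optimality conditions in the proof of Lemma 1.
If unit vectors `v₁, w₁ ∈ E` achieve the maximum
`c₁ = max{⟪v, i·w⟫_ℝ : v, w ∈ E, ‖v‖ = ‖w‖ = 1} > 0`, then (a) `⟪v₁, w₁⟫_ℝ = 0`, and
(b) every `z ∈ E` that is ℝ-orthogonal to both `v₁` and `w₁` is ℂ-orthogonal to both. -/
theorem maximizer_orthogonality_conditions {n : ℕ}
    (E : Submodule ℝ (EuclideanSpace ℂ (Fin n)))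
    (v₁ w₁ : EuclideanSpace ℂ (Fin n)) (c₁ : ℝ)
    (hv₁ : v₁ ∈ E) (hw₁ : w₁ ∈ E) (hv₁n : ‖v₁‖ = 1) (hw₁n : ‖w₁‖ = 1)
    (hmax : ∀ v w : EuclideanSpace ℂ (Fin n), v ∈ E → w ∈ E → ‖v‖ = 1 → ‖w‖ = 1 →
      inner (𝕜 := ℝ) v (Complex.I • w) ≤ c₁)
    (hc₁ : c₁ = inner (𝕜 := ℝ) v₁ (Complex.I • w₁))
    (hc₁pos : 0 < c₁) :
    inner (𝕜 := ℝ) v₁ w₁ = (0 : ℝ) ∧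
    (∀ z : EuclideanSpace ℂ (Fin n), z ∈ E →
      inner (𝕜 := ℝ) z v₁ = (0 : ℝ) → inner (𝕜 := ℝ) z w₁ = (0 : ℝ) →
      inner (𝕜 := ℂ) z v₁ = (0 : ℂ) ∧ inner (𝕜 := ℂ) z w₁ = (0 : ℂ)) := by
  have hv : ∀ y ∈ E, inner ℝ y (Complex.I • w₁) = c₁ * inner ℝ y v₁ := by
    intro y hy
    rw [hc₁]
    exact inner_eq_mul_inner_of_forall_unit_inner_le E hv₁ hv₁n (hc₁ ▸ hc₁pos.le)
      (fun u hu hun => hc₁ ▸ hmax u w₁ hu hw₁ hun hw₁n) hy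
  have hw : ∀ y ∈ E, inner ℝ v₁ (Complex.I • y) = c₁ * inner ℝ y w₁ := by
    intro y hy
    rw [hc₁]
    simp only [← EuclideanSpace.real_inner_I_smul_swap _ v₁] at hc₁ ⊢
    refine inner_eq_mul_inner_of_forall_unit_inner_le E hw₁ hw₁n (hc₁ ▸ hc₁pos.le)
      (fun u hu hun => ?_) hy
    rw [← hc₁, EuclideanSpace.real_inner_I_smul_swap]
    exact hmax v₁ u hv₁ hu hv₁n hun
  refine ⟨?_, fun z hz hzv hzw => ⟨?_, ?_⟩⟩
  · have h := hv w₁ hw₁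
    have him : (inner ℂ w₁ w₁).im = 0 := inner_self_im (𝕜 := ℂ) w₁
    rw [EuclideanSpace.real_inner_I_smul_right, him, neg_zero, eq_comm, mul_eq_zero] at h
    rw [real_inner_comm]
    exact h.resolve_left hc₁pos.ne'
  · have h := hw z hz
    rw [hzw, mul_zero, ← EuclideanSpace.real_inner_I_smul_swap, inner_neg_right,
      EuclideanSpace.real_inner_I_smul_right, neg_neg] at h
    rw [EuclideanSpace.real_inner_eq_re_inner] at hzv
    exact Complex.ext hzv h
  · have h := hv z hz
    rw [hzv, mul_zero, EuclideanSpace.real_inner_I_smul_right, neg_eq_zero] at h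
    rw [EuclideanSpace.real_inner_eq_re_inner] at hzw
    exact Complex.ext hzw h
end

section
/- Let n, L be positive integers, let c_1,…,c_L ∈ [0,1], and let v_1, w_1, …, v_L, w_L ∈ ℂ^n satisfy v_mᴴv_n = δ_{mn}, w_mᴴw_n = δ_{mn}, and v_mᴴw_n = −δ_{mn}·i·c_m for all m,n. Let V = (v_1, w_1, …, v_L, w_L) ∈ ℂ^{n×2L}. Then for every P > 0 and every matrix M ∈ ℂ^{n×m} with Tr(MMᴴ) = P such that Re(Vᴴ M Mᴴ V) is invertible, one has Tr[ (Re(Vᴴ M Mᴴ V))⁻¹ ] ≥ (4/P)·( Σ_{k=1}^{L} 1/√(1+c_k) )². -/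
open Matrix

open scoped InnerProductSpace in
/-- Bessel-type inequality for two orthonormal families that are biorthogonal up to
the factors `-i c_k`. -/
theorem sum_inv_one_add_mul_norm_inner_sq_le {ι E : Type*} [Fintype ι] [DecidableEq ι]
    [NormedAddCommGroup E] [InnerProductSpace ℂ E] (v w : ι → E) (c : ι → ℝ)
    (hc : ∀ k, 0 ≤ c k)
    (hvv : ∀ k l, ⟪v k, v l⟫_ℂ = if k = l then 1 else 0)
    (hww : ∀ k l, ⟪w k, w l⟫_ℂ = if k = l then 1 else 0)
    (hvw : ∀ k l, ⟪v k, w l⟫_ℂ = if k = l then -(Complex.I * (c k : ℂ)) else 0) (x : E) :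
    ∑ k, (1 + c k)⁻¹ * (‖⟪v k, x⟫_ℂ‖ ^ 2 + ‖⟪w k, x⟫_ℂ‖ ^ 2) ≤ ‖x‖ ^ 2 := by
  have hwv : ∀ k l, ⟪w k, v l⟫_ℂ = if k = l then Complex.I * (c k : ℂ) else 0 := by
    intro k l
    rw [← inner_conj_symm, hvw]
    by_cases h : l = k
    · subst h; simp
    · simp [h, Ne.symm h]
  set s : ι → ℝ := fun k => (1 + c k)⁻¹ with hs
  set z : E := ∑ k, ((s k * ⟪v k, x⟫_ℂ) • v k + (s k * ⟪w k, x⟫_ℂ) • w k) with hz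
  have hvz : ∀ k, ⟪v k, z⟫_ℂ = s k * (⟪v k, x⟫_ℂ - Complex.I * c k * ⟪w k, x⟫_ℂ) := by
    intro k
    simp only [hz, inner_sum, inner_add_right, inner_smul_right, hvv, hvw, mul_ite, mul_one,
      mul_zero, Finset.sum_add_distrib, Finset.sum_ite_eq, Finset.mem_univ, if_true]
    ring
  have hwz : ∀ k, ⟪w k, z⟫_ℂ = s k * (⟪w k, x⟫_ℂ + Complex.I * c k * ⟪v k, x⟫_ℂ) := by
    intro k
    simp only [hz, inner_sum, inner_add_right, inner_smul_right, hwv, hww, mul_ite, mul_one,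
      mul_zero, Finset.sum_add_distrib, Finset.sum_ite_eq, Finset.mem_univ, if_true]
    ring
  have hzy : ∀ y : E, ⟪z, y⟫_ℂ = ∑ k, ((s k : ℂ) * (starRingEnd ℂ ⟪v k, x⟫_ℂ * ⟪v k, y⟫_ℂ
      + starRingEnd ℂ ⟪w k, x⟫_ℂ * ⟪w k, y⟫_ℂ)) := by
    intro y
    simp only [hz, sum_inner, inner_add_left, inner_smul_left, map_mul, Complex.conj_ofReal]
    exact Finset.sum_congr rfl fun k _ => by ring
  have hzx : (⟪z, x⟫_ℂ).re = ∑ k, s k * (‖⟪v k, x⟫_ℂ‖ ^ 2 + ‖⟪w k, x⟫_ℂ‖ ^ 2) := by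
    rw [hzy, Complex.re_sum]
    refine Finset.sum_congr rfl fun k _ => ?_
    simp only [Complex.conj_mul', Complex.re_ofReal_mul]
    norm_cast
  have hzz : (⟪z, z⟫_ℂ).re ≤ ∑ k, s k * (‖⟪v k, x⟫_ℂ‖ ^ 2 + ‖⟪w k, x⟫_ℂ‖ ^ 2) := by
    rw [hzy, Complex.re_sum]
    refine Finset.sum_le_sum fun k _ => ?_
    have hk := hc k
    have hs0 : 0 ≤ s k := by simp only [hs]; positivity
    have hs1 : s k * (1 + c k) = 1 := inv_mul_cancel₀ (by positivity)
    rw [hvz, hwz, Complex.re_ofReal_mul]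
    refine mul_le_mul_of_nonneg_left ?_ hs0
    generalize ⟪v k, x⟫_ℂ = a
    generalize ⟪w k, x⟫_ℂ = b
    have key : (starRingEnd ℂ a * (s k * (a - Complex.I * c k * b))
        + starRingEnd ℂ b * (s k * (b + Complex.I * c k * a))).re
        = ‖a‖ ^ 2 + ‖b‖ ^ 2 - s k * c k * ((a.re - b.im) ^ 2 + (a.im + b.re) ^ 2) := by
      rw [Complex.sq_norm, Complex.sq_norm, Complex.normSq_apply, Complex.normSq_apply]
      simp
      linear_combination (a.re * a.re + a.im * a.im + (b.re * b.re + b.im * b.im)) * hs1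
    rw [key]
    have : 0 ≤ s k * c k * ((a.re - b.im) ^ 2 + (a.im + b.re) ^ 2) := by positivity
    linarith
  have hnn : 0 ≤ ‖x - z‖ ^ 2 := sq_nonneg _
  rw [@norm_sub_sq ℂ, ← inner_conj_symm] at hnn
  have hzn : ‖z‖ ^ 2 = (⟪z, z⟫_ℂ).re := norm_sq_eq_re_inner (𝕜 := ℂ) z
  simp only [RCLike.re_to_complex, Complex.conj_re] at hnn
  linarith

/-- A weighted Cauchy-Schwarz inequality between the diagonals of a positive semidefinite
matrix and of its inverse. -/
theorem Matrix.PosSemidef.sq_sum_le_trace_inv_mul {ι : Type*} [Fintype ι] [DecidableEq ι]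
    {J : Matrix ι ι ℝ} (hJ : J.PosSemidef) (hu : IsUnit J) (d : ι → ℝ) :
    (∑ j, d j) ^ 2 ≤ J⁻¹.trace * ∑ j, d j ^ 2 * J j j := by
  have hdet := (Matrix.isUnit_iff_isUnit_det J).1 hu
  have hJt : J⁻¹ᴴ = J⁻¹ := by rw [Matrix.conjTranspose_nonsing_inv, hJ.isHermitian.eq]
  have hDJ : (Matrix.diagonal d * J * Matrix.diagonal d).trace = ∑ j, d j ^ 2 * J j j := by
    simp only [Matrix.trace, Matrix.diag_apply, Matrix.mul_diagonal, Matrix.diagonal_mul]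
    exact Finset.sum_congr rfl fun j _ => by ring
  have hq : ∀ t : ℝ, 0 ≤ J⁻¹.trace * (t * t) + (-2 * ∑ j, d j) * t + ∑ j, d j ^ 2 * J j j := by
    intro t
    have h := (hJ.conjTranspose_mul_mul_same (t • J⁻¹ - Matrix.diagonal d)).trace_nonneg
    have e : (t • J⁻¹ - Matrix.diagonal d)ᴴ * J * (t • J⁻¹ - Matrix.diagonal d)
        = (t * t) • J⁻¹ - (2 * t) • Matrix.diagonal d
          + Matrix.diagonal d * J * Matrix.diagonal d := by
      have hd : (Matrix.diagonal d)ᴴ = Matrix.diagonal d := by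
        simp
      rw [Matrix.conjTranspose_sub, Matrix.conjTranspose_smul, hJt, hd, star_trivial]
      simp only [sub_mul, mul_sub, smul_mul_assoc, mul_smul_comm, Matrix.nonsing_inv_mul _ hdet,
        mul_assoc, Matrix.mul_nonsing_inv _ hdet, one_mul, mul_one]
      module
    rw [e, Matrix.trace_add, Matrix.trace_sub, Matrix.trace_smul, Matrix.trace_smul, hDJ,
      Matrix.trace_diagonal, smul_eq_mul, smul_eq_mul] at h
    linarith
  have := discrim_le_zero hq
  rw [discrim] at this
  linarith

/-- The entrywise real part of a complex Gram matrix is positive semidefinite. -/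
theorem Matrix.posSemidef_map_re_mul_conjTranspose {ι κ : Type*} [Fintype ι] [Fintype κ]
    (A : Matrix ι κ ℂ) : ((A * Aᴴ).map Complex.re).PosSemidef := by
  have : (A * Aᴴ).map Complex.re
      = A.map Complex.re * (A.map Complex.re)ᴴ + A.map Complex.im * (A.map Complex.im)ᴴ := by
    ext i j
    simp [Matrix.mul_apply, Finset.sum_add_distrib]
  rw [this]
  exact (Matrix.posSemidef_self_mul_conjTranspose _).add
    (Matrix.posSemidef_self_mul_conjTranspose _)

theorem Fin.sum_two_mul_eq_sum_add {α : Type*} [AddCommMonoid α] {L : ℕ} (g h : Fin L → α) :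
    ∑ j : Fin (2 * L), (if (j : ℕ) % 2 = 0 then g ⟨(j : ℕ) / 2, by have := j.isLt; omega⟩
      else h ⟨(j : ℕ) / 2, by have := j.isLt; omega⟩) = ∑ k, (g k + h k) := by
  rw [← (finProdFinEquiv.trans (finCongr (Nat.mul_comm L 2))).sum_comp, Fintype.sum_prod_type]
  refine Finset.sum_congr rfl fun k _ => ?_
  have h1 : (1 + 2 * (k : ℕ)) / 2 = k := by omega
  simp [Fin.sum_univ_two, h1]

/-- lower bound of Theorem 3, even case `N_p = 2L`. Given an
ℝ-orthonormal family `v_1, w_1, …, v_L, w_L` with `v_mᴴw_n = −δ_{mn}·i·c_m`, `c_m ∈ [0,1]`,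
arranged as the columns of `V = (v_1, w_1, …, v_L, w_L)`, every observation matrix `M`
with `Tr(MMᴴ) = P` and `Re(Vᴴ M Mᴴ V)` invertible satisfies
`Tr[(Re(Vᴴ M Mᴴ V))⁻¹] ≥ (4/P)·(Σ_k 1/√(1+c_k))²`. -/
theorem crb_lower_bound_even {n L m : ℕ} (hn : 0 < n) (hL : 0 < L)
    (v w : Fin L → (Fin n → ℂ)) (c : Fin L → ℝ)
    (hc : ∀ k, 0 ≤ c k ∧ c k ≤ 1)
    (hvv : ∀ k l, star (v k) ⬝ᵥ v l = if k = l then 1 else 0)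
    (hww : ∀ k l, star (w k) ⬝ᵥ w l = if k = l then 1 else 0)
    (hvw : ∀ k l, star (v k) ⬝ᵥ w l = if k = l then -(Complex.I * (c k : ℂ)) else 0)
    (V : Matrix (Fin n) (Fin (2 * L)) ℂ)
    (hV : V = Matrix.of fun (i : Fin n) (j : Fin (2 * L)) =>
      if (j : ℕ) % 2 = 0 then v ⟨(j : ℕ) / 2, by have := j.isLt; omega⟩ i
      else w ⟨(j : ℕ) / 2, by have := j.isLt; omega⟩ i)
    (P : ℝ) (hP : 0 < P)
    (M : Matrix (Fin n) (Fin m) ℂ)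
    (hpow : (M * Mᴴ).trace = (P : ℂ))
    (hinv : IsUnit ((Vᴴ * M * Mᴴ * V).map Complex.re)) :
    (4 / P) * (∑ k, 1 / Real.sqrt (1 + c k)) ^ 2 ≤
      (((Vᴴ * M * Mᴴ * V).map Complex.re)⁻¹).trace := by
  set a : Fin L → ℝ := fun k => 1 / Real.sqrt (1 + c k) with ha
  have ha2 : ∀ k, a k ^ 2 = (1 + c k)⁻¹ := fun k => by
    rw [ha, div_pow, Real.sq_sqrt (by linarith [(hc k).1]), one_pow, one_div]
  have hJ : Vᴴ * M * Mᴴ * V = (Vᴴ * M) * (Vᴴ * M)ᴴ := by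
    rw [Matrix.conjTranspose_mul, Matrix.conjTranspose_conjTranspose]
    simp only [Matrix.mul_assoc]
  have hdiag : ∀ j, ((Vᴴ * M * Mᴴ * V).map Complex.re) j j
      = ∑ i, ‖star (V.col j) ⬝ᵥ M.col i‖ ^ 2 := by
    intro j
    rw [hJ, Matrix.map_apply, Matrix.mul_apply, Complex.re_sum]
    refine Finset.sum_congr rfl fun i _ => ?_
    rw [Matrix.conjTranspose_apply, ← starRingEnd_apply, Complex.mul_conj']
    norm_cast
  have hpsd : ((Vᴴ * M * Mᴴ * V).map Complex.re).PosSemidef := by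
    rw [hJ]; exact Matrix.posSemidef_map_re_mul_conjTranspose _
  have htr : 0 ≤ (((Vᴴ * M * Mᴴ * V).map Complex.re)⁻¹).trace := hpsd.inv.trace_nonneg
  have hcs := hpsd.sq_sum_le_trace_inv_mul hinv
    (fun j => a ⟨(j : ℕ) / 2, by have := j.isLt; omega⟩)
  have hsum : ∑ j : Fin (2 * L), a ⟨(j : ℕ) / 2, by have := j.isLt; omega⟩ = 2 * ∑ k, a k := by
    have := Fin.sum_two_mul_eq_sum_add a a
    simp only [ite_self] at this
    rw [this, Finset.sum_add_distrib, two_mul]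
  have hbessel : ∀ i, ∑ k, (1 + c k)⁻¹ * (‖star (v k) ⬝ᵥ M.col i‖ ^ 2
      + ‖star (w k) ⬝ᵥ M.col i‖ ^ 2) ≤ ∑ l, ‖M l i‖ ^ 2 := by
    intro i
    have h := sum_inv_one_add_mul_norm_inner_sq_le (fun k => WithLp.toLp 2 (v k))
      (fun k => WithLp.toLp 2 (w k)) c (fun k => (hc k).1)
      (fun k l => by rw [EuclideanSpace.inner_toLp_toLp, dotProduct_comm, hvv])
      (fun k l => by rw [EuclideanSpace.inner_toLp_toLp, dotProduct_comm, hww])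
      (fun k l => by rw [EuclideanSpace.inner_toLp_toLp, dotProduct_comm, hvw])
      (WithLp.toLp 2 (M.col i))
    simpa only [EuclideanSpace.inner_toLp_toLp, dotProduct_comm (M.col i),
      EuclideanSpace.norm_sq_eq, Matrix.col_apply] using h
  have hP' : ∑ i, ∑ l, ‖M l i‖ ^ 2 = P := by
    have h := congrArg Complex.re hpow
    rw [Complex.ofReal_re, Matrix.trace, Complex.re_sum] at h
    rw [← h, Finset.sum_comm]
    refine Finset.sum_congr rfl fun l _ => ?_
    rw [Matrix.diag_apply, Matrix.mul_apply, Complex.re_sum]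
    refine Finset.sum_congr rfl fun i _ => ?_
    rw [Matrix.conjTranspose_apply, ← starRingEnd_apply, Complex.mul_conj']
    norm_cast
  have hle : ∑ j : Fin (2 * L), a ⟨(j : ℕ) / 2, by have := j.isLt; omega⟩ ^ 2
      * ((Vᴴ * M * Mᴴ * V).map Complex.re) j j ≤ P := by
    set g : Fin L → ℝ := fun k => (1 + c k)⁻¹ * ∑ i, ‖star (v k) ⬝ᵥ M.col i‖ ^ 2 with hg
    set h : Fin L → ℝ := fun k => (1 + c k)⁻¹ * ∑ i, ‖star (w k) ⬝ᵥ M.col i‖ ^ 2 with hh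
    have e : ∀ j : Fin (2 * L), a ⟨(j : ℕ) / 2, by have := j.isLt; omega⟩ ^ 2
        * ((Vᴴ * M * Mᴴ * V).map Complex.re) j j
        = if (j : ℕ) % 2 = 0 then
            g ⟨(j : ℕ) / 2, by have := j.isLt; omega⟩
          else h ⟨(j : ℕ) / 2, by have := j.isLt; omega⟩ := by
      intro j
      rw [hdiag, ha2]
      have hcol : V.col j = if (j : ℕ) % 2 = 0 then v ⟨(j : ℕ) / 2, by have := j.isLt; omega⟩
          else w ⟨(j : ℕ) / 2, by have := j.isLt; omega⟩ := by
        ext i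
        rw [hV]
        split_ifs with hj <;> simp [Matrix.col_apply, hj]
      rw [hcol]
      split_ifs <;> rfl
    rw [Finset.sum_congr rfl fun j _ => e j, Fin.sum_two_mul_eq_sum_add, ← hP']
    refine le_trans (le_of_eq ?_) (Finset.sum_le_sum fun i _ => hbessel i)
    rw [Finset.sum_comm]
    refine Finset.sum_congr rfl fun k _ => ?_
    simp only [hg, hh]
    rw [← mul_add, ← Finset.sum_add_distrib, Finset.mul_sum]
  rw [hsum] at hcs
  rw [div_mul_eq_mul_div, div_le_iff₀ hP]
  calc 4 * (∑ k, a k) ^ 2 = (2 * ∑ k, a k) ^ 2 := by ring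
    _ ≤ _ := hcs
    _ ≤ _ := mul_le_mul_of_nonneg_left hle htr
end

section
/- Let n, L be positive integers, let c_1,…,c_L ∈ [0,1], and let v_1, w_1, …, v_L, w_L ∈ ℂ^n satisfy v_mᴴv_n = δ_{mn}, w_mᴴw_n = δ_{mn}, and v_mᴴw_n = −δ_{mn}·i·c_m for all m,n. Let V = (v_1, w_1, …, v_L, w_L) ∈ ℂ^{n×2L}, let P > 0, set C = 2·Σ_{l=1}^{L} 1/√(1+c_l), and define M ∈ ℂ^{n×L} to have k-th column √(P/C)·(v_k + i·w_k)/(1+c_k)^{3/4}. Then: (a) Tr(MMᴴ) = P; (b) Re(Vᴴ M Mᴴ V) is invertible (indeed diagonal with k-th diagonal pair of entries both equal to (P/C)·√(1+c_k)); and (c) Tr[ (Re(Vᴴ M Mᴴ V))⁻¹ ] = (4/P)·( Σ_{k=1}^{L} 1/√(1+c_k) )². -/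
open Matrix

lemma Fin.sum_div_two {L : ℕ} (f : Fin L → ℝ) :
    ∑ j : Fin (2 * L), f ⟨(j : ℕ) / 2, by have := j.isLt; omega⟩ = 2 * ∑ k, f k := by
  rw [← (finProdFinEquiv.trans (finCongr (mul_comm L 2))).sum_comp, Fintype.sum_prod_type,
    Finset.mul_sum]
  refine Finset.sum_congr rfl fun k _ => ?_
  have h (b : Fin 2) : ((b : ℕ) + 2 * k) / 2 = k := by have := b.isLt; omega
  simp only [Fin.sum_univ_two, Equiv.trans_apply, finCongr_apply, Fin.val_cast,
    finProdFinEquiv_apply_val, h, Fin.eta]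
  ring

lemma Real.sq_rpow_three_div_four {x : ℝ} (hx : 0 ≤ x) :
    (x ^ ((3 : ℝ) / 4)) ^ 2 = x * √x := by
  rw [← Real.rpow_natCast, ← Real.rpow_mul hx, Real.sqrt_eq_rpow,
    ← Real.rpow_one_add' hx (by norm_num)]
  norm_num

/-- The Gram matrix of a two-per-row pattern: if row `j` of `A` is supported at column `j / 2`,
with entry `a` for even `j` and `i a` for odd `j`, then `Re (A Aᴴ)` is diagonal. -/
lemma Matrix.re_mul_conjTranspose_eq_diagonal {L : ℕ} (a : Fin L → ℝ)
    (A : Matrix (Fin (2 * L)) (Fin L) ℂ)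
    (hA : ∀ j k, A j k = if (⟨(j : ℕ) / 2, by have := j.isLt; omega⟩ : Fin L) = k then
      (if (j : ℕ) % 2 = 0 then 1 else Complex.I) * (a k : ℂ) else 0) :
    (A * Aᴴ).map Complex.re =
      diagonal fun j : Fin (2 * L) => a ⟨(j : ℕ) / 2, by have := j.isLt; omega⟩ ^ 2 := by
  ext j j'
  simp only [map_apply, mul_apply, conjTranspose_apply, hA, ite_mul, zero_mul,
    Finset.sum_ite_eq, Finset.mem_univ, if_true, diagonal_apply]
  by_cases hj : j = j'
  · subst hj
    split_ifs <;> simp [sq] at *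
  · rw [if_neg hj]
    by_cases hd : (j' : ℕ) / 2 = j / 2
    · have hne : (j : ℕ) ≠ j' := fun h => hj (Fin.ext h)
      rcases Nat.mod_two_eq_zero_or_one j with h | h <;>
        rcases Nat.mod_two_eq_zero_or_one j' with h' | h'
      · omega
      · simp [h, h', hd]
      · simp [h, h', hd]
      · omega
    · simp [hd]

/-- attainment part of Theorem 3, even case `N_p = 2L`. With
`V = (v_1, w_1, …, v_L, w_L)` as in the decomposition of the variation space,
`C = 2·Σ_l 1/√(1+c_l)` and `M` the matrix whose `k`-th column is
`√(P/C)·(v_k + i·w_k)/(1+c_k)^{3/4}`, one has `Tr(MMᴴ) = P`, the matrix `Re(Vᴴ M Mᴴ V)`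
is diagonal with `k`-th diagonal pair of entries `(P/C)·√(1+c_k)` (hence invertible), and
`Tr[(Re(Vᴴ M Mᴴ V))⁻¹] = (4/P)·(Σ_k 1/√(1+c_k))²`. -/
theorem crb_attainment_even {n L : ℕ} (hn : 0 < n) (hL : 0 < L)
    (v w : Fin L → (Fin n → ℂ)) (c : Fin L → ℝ)
    (hc : ∀ k, 0 ≤ c k ∧ c k ≤ 1)
    (hvv : ∀ k l, star (v k) ⬝ᵥ v l = if k = l then 1 else 0)
    (hww : ∀ k l, star (w k) ⬝ᵥ w l = if k = l then 1 else 0)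
    (hvw : ∀ k l, star (v k) ⬝ᵥ w l = if k = l then -(Complex.I * (c k : ℂ)) else 0)
    (V : Matrix (Fin n) (Fin (2 * L)) ℂ)
    (hV : V = Matrix.of fun (i : Fin n) (j : Fin (2 * L)) =>
      if (j : ℕ) % 2 = 0 then v ⟨(j : ℕ) / 2, by have := j.isLt; omega⟩ i
      else w ⟨(j : ℕ) / 2, by have := j.isLt; omega⟩ i)
    (P : ℝ) (hP : 0 < P)
    (C : ℝ) (hC : C = 2 * ∑ l, 1 / Real.sqrt (1 + c l))
    (M : Matrix (Fin n) (Fin L) ℂ)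
    (hM : M = Matrix.of fun (i : Fin n) (k : Fin L) =>
      ((Real.sqrt (P / C) / (1 + c k) ^ ((3 : ℝ) / 4) : ℝ) : ℂ) *
        (v k i + Complex.I * w k i)) :
    (M * Mᴴ).trace = (P : ℂ) ∧
    (Vᴴ * M * Mᴴ * V).map Complex.re =
      Matrix.diagonal (fun j : Fin (2 * L) =>
        (P / C) * Real.sqrt (1 + c ⟨(j : ℕ) / 2, by have := j.isLt; omega⟩)) ∧
    IsUnit ((Vᴴ * M * Mᴴ * V).map Complex.re) ∧
    (((Vᴴ * M * Mᴴ * V).map Complex.re)⁻¹).trace =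
      (4 / P) * (∑ k, 1 / Real.sqrt (1 + c k)) ^ 2 := by
  have hpos k : 0 < 1 + c k := by linarith [(hc k).1]
  have hsqrt k : 0 < √(1 + c k) := Real.sqrt_pos.2 (hpos k)
  have hS : 0 < ∑ l, 1 / √(1 + c l) :=
    Finset.sum_pos (fun l _ => one_div_pos.2 (hsqrt l)) ⟨⟨0, hL⟩, Finset.mem_univ _⟩
  have hCpos : 0 < C := by rw [hC]; positivity
  set s : Fin L → ℝ := fun k => √(P / C) / (1 + c k) ^ ((3 : ℝ) / 4) with hs
  have hs2 k : s k ^ 2 * (1 + c k) = P / C * (1 / √(1 + c k)) := by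
    have := (hpos k).ne'
    have := (hsqrt k).ne'
    simp only [hs]
    rw [div_pow, Real.sq_sqrt (by positivity), Real.sq_rpow_three_div_four (hpos k).le]
    field_simp
  have hwv k l : star (w k) ⬝ᵥ v l = if k = l then Complex.I * (c k : ℂ) else 0 := by
    have h := congrArg star (hvw l k)
    rw [← star_dotProduct_star, star_star] at h
    rw [dotProduct_comm, dotProduct_comm] at h
    rw [h]
    by_cases hkl : k = l
    · simp [hkl]
    · simp [hkl, Ne.symm hkl]
  set u : Fin L → Fin n → ℂ := fun k => v k + Complex.I • w k with hu
  have hvu k l : star (v k) ⬝ᵥ u l = if k = l then (1 + c k : ℂ) else 0 := by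
    simp only [hu, dotProduct_add, dotProduct_smul, hvv, hvw, smul_eq_mul]
    split_ifs
    · linear_combination -(c k : ℂ) * Complex.I_mul_I
    · simp
  have hwu k l : star (w k) ⬝ᵥ u l = if k = l then Complex.I * (1 + c k : ℂ) else 0 := by
    simp only [hu, dotProduct_add, dotProduct_smul, hww, hwv, smul_eq_mul]
    split_ifs
    · ring
    · simp
  have huu k : star (u k) ⬝ᵥ u k = 2 * (1 + c k : ℂ) := by
    have h : star (u k) = star (v k) - Complex.I • star (w k) := by
      ext i; simp [hu, sub_eq_add_neg]
    rw [h, sub_dotProduct, smul_dotProduct, hvu, hwu, if_pos rfl, if_pos rfl, smul_eq_mul]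
    linear_combination -(1 + c k : ℂ) * Complex.I_mul_I
  have hMu i k : M i k = (s k : ℂ) * u k i := by simp [hM, hs, hu]
  have hVM j k : (Vᴴ * M) j k = if (⟨(j : ℕ) / 2, by have := j.isLt; omega⟩ : Fin L) = k then
      (if (j : ℕ) % 2 = 0 then 1 else Complex.I) * ((s k * (1 + c k) : ℝ) : ℂ) else 0 := by
    have h : (Vᴴ * M) j k = (s k : ℂ) * (star (fun i => V i j) ⬝ᵥ u k) := by
      simp only [mul_apply, conjTranspose_apply, dotProduct, Pi.star_apply, hMu, Finset.mul_sum]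
      exact Finset.sum_congr rfl fun i _ => by ring
    rw [h]
    by_cases hj : (j : ℕ) % 2 = 0
    · simp only [hV, of_apply, hj, if_true]
      rw [hvu]
      split_ifs with hk
      · subst hk; push_cast; ring
      · simp
    · simp only [hV, of_apply, hj, if_false]
      rw [hwu]
      split_ifs with hk
      · subst hk; push_cast; ring
      · simp
  have hdiag : (Vᴴ * M * Mᴴ * V).map Complex.re =
      Matrix.diagonal (fun j : Fin (2 * L) =>
        (P / C) * √(1 + c ⟨(j : ℕ) / 2, by have := j.isLt; omega⟩)) := by
    have h : Vᴴ * M * Mᴴ * V = (Vᴴ * M) * (Vᴴ * M)ᴴ := by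
      simp [conjTranspose_mul, Matrix.mul_assoc]
    rw [h, re_mul_conjTranspose_eq_diagonal _ _ hVM]
    congr 1
    ext j
    generalize (⟨(j : ℕ) / 2, _⟩ : Fin L) = k
    have h1 := (hsqrt k).ne'
    calc (s k * (1 + c k)) ^ 2 = s k ^ 2 * (1 + c k) * (1 + c k) := by ring
      _ = P / C * (1 / √(1 + c k)) * √(1 + c k) ^ 2 := by
        rw [hs2, Real.sq_sqrt (hpos k).le]
      _ = _ := by field_simp
  have hne j : P / C * √(1 + c j) ≠ 0 := (mul_pos (div_pos hP hCpos) (hsqrt j)).ne'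
  refine ⟨?_, hdiag, ?_, ?_⟩
  · rw [trace_mul_comm]
    have h k : (Mᴴ * M) k k = ((2 * (P / C * (1 / √(1 + c k))) : ℝ) : ℂ) := by
      have h' : (Mᴴ * M) k k = (s k : ℂ) ^ 2 * (star (u k) ⬝ᵥ u k) := by
        simp only [mul_apply, conjTranspose_apply, dotProduct, Pi.star_apply, hMu, Finset.mul_sum]
        refine Finset.sum_congr rfl fun i _ => ?_
        simp only [star_mul', Complex.star_def, Complex.conj_ofReal]
        ring
      rw [h', huu, ← hs2]
      push_cast
      ring
    simp only [trace, diag_apply, h]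
    rw [← Complex.ofReal_sum, ← Finset.mul_sum, ← Finset.mul_sum]
    congr 1
    rw [hC]
    field_simp
  · rw [hdiag, isUnit_diagonal, Pi.isUnit_iff]
    exact fun j => (hne _).isUnit
  · rw [hdiag]
    have hinv : (Matrix.diagonal (fun j : Fin (2 * L) =>
        (P / C) * √(1 + c ⟨(j : ℕ) / 2, by have := j.isLt; omega⟩)))⁻¹ =
        Matrix.diagonal (fun j : Fin (2 * L) =>
        ((P / C) * √(1 + c ⟨(j : ℕ) / 2, by have := j.isLt; omega⟩))⁻¹) := by
      refine inv_eq_right_inv ?_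
      rw [diagonal_mul_diagonal, ← diagonal_one]
      congr 1
      ext j
      exact mul_inv_cancel₀ (hne _)
    rw [hinv, trace_diagonal, Fin.sum_div_two fun k => (P / C * √(1 + c k))⁻¹]
    have h k : (P / C * √(1 + c k))⁻¹ = C / P * (1 / √(1 + c k)) := by
      rw [mul_inv, inv_div, one_div]
    simp only [h]
    rw [← Finset.mul_sum, hC]
    ring
end

section
/- Let n, L be positive integers, let c_1,…,c_L ∈ [0,1], and let v_1, w_1, …, v_L, w_L, v_{L+1} ∈ ℂ^n satisfy v_mᴴv_n = δ_{mn} and w_mᴴw_n = δ_{mn} (indices up to L+1 for the v's with w's up to L), v_mᴴw_n = −δ_{mn}·i·c_m, and v_{L+1} of unit norm with v_{L+1}ᴴv_k = 0, v_{L+1}ᴴw_k = 0 for all k ≤ L. Let V = (v_1, w_1, …, v_L, w_L, v_{L+1}) ∈ ℂ^{n×(2L+1)}. Then for every P > 0 and every M ∈ ℂ^{n×m} with Tr(MMᴴ) = P such that Re(Vᴴ M Mᴴ V) is invertible, one has Tr[ (Re(Vᴴ M Mᴴ V))⁻¹ ] ≥ (4/P)·( Σ_{k=1}^{L} 1/√(1+c_k)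 + 1/2 )². -/
open Matrix

/-- A sum over `2 * L + 1` indices, grouped into `L` consecutive pairs and a last term. -/
theorem Fin.sum_univ_pairs_add_last {α : Type*} [AddCommMonoid α] :
    ∀ (L : ℕ) (f : Fin (2 * L + 1) → α),
      ∑ j, f j = ∑ k : Fin L, (f ⟨2 * k, by omega⟩ + f ⟨2 * k + 1, by omega⟩)
        + f ⟨2 * L, by omega⟩
  | 0, f => by simp
  | L + 1, f => by
    have h := Fin.sum_univ_pairs_add_last L fun j => f ⟨j, by omega⟩
    rw [Fin.sum_univ_castSucc (n := L)]
    refine (Fin.sum_univ_castSucc (n := 2 * L + 2) f).trans ?_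
    refine congrArg₂ (· + ·) ?_ rfl
    refine (Fin.sum_univ_castSucc (n := 2 * L + 1) _).trans ?_
    exact (congrArg₂ (· + ·) h rfl).trans (add_assoc _ _ _)

/-- For a positive semidefinite invertible `J` and a real weight vector `d`,
`2 Σ d_j - Σ d_j² J_jj ≤ Tr J⁻¹`. -/
theorem Matrix.PosSemidef.two_mul_sum_sub_le_trace_inv {ι : Type*} [Fintype ι] [DecidableEq ι]
    {J : Matrix ι ι ℝ} (hJ : J.PosSemidef) (hu : IsUnit J) (d : ι → ℝ) :
    2 * ∑ j, d j - ∑ j, d j ^ 2 * J j j ≤ J⁻¹.trace := by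
  have hdet : IsUnit J.det := (Matrix.isUnit_iff_isUnit_det J).mp hu
  have h := (hJ.conjTranspose_mul_mul_same (J⁻¹ - diagonal d)).trace_nonneg
  have hs : (J⁻¹ - diagonal d)ᴴ = J⁻¹ - diagonal d := by
    rw [conjTranspose_sub, hJ.isHermitian.inv.eq, diagonal_conjTranspose]
    simp
  have e : (J⁻¹ - diagonal d) * J * (J⁻¹ - diagonal d)
      = J⁻¹ - diagonal d - diagonal d + diagonal d * J * diagonal d := by
    simp only [sub_mul, mul_sub, Matrix.nonsing_inv_mul J hdet, Matrix.one_mul,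
      Matrix.mul_assoc, Matrix.mul_nonsing_inv J hdet, Matrix.mul_one]
    abel
  rw [hs, e, trace_add, trace_sub, trace_sub, trace_diagonal] at h
  have ht : (diagonal d * J * diagonal d).trace = ∑ j, d j ^ 2 * J j j := by
    simp only [trace, diag, mul_diagonal, diagonal_mul]
    exact Finset.sum_congr rfl fun j _ => by ring
  rw [ht] at h
  linarith

/-- The real part of a complex Gram matrix is positive semidefinite. -/
theorem Matrix.posSemidef_map_re_conjTranspose_mul_self {ι κ : Type*} [Fintype ι] [Fintype κ]
    (N : Matrix κ ι ℂ) : ((Nᴴ * N).map Complex.re).PosSemidef := by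
  have e : (Nᴴ * N).map Complex.re
      = (N.map Complex.re)ᴴ * N.map Complex.re + (N.map Complex.im)ᴴ * N.map Complex.im := by
    ext i j
    simp [Matrix.mul_apply, Finset.sum_add_distrib]
  rw [e]
  exact (posSemidef_conjTranspose_mul_self _).add (posSemidef_conjTranspose_mul_self _)

/-- A Bessel inequality for unit vectors that are orthogonal except inside the pairs
`(v k, w k)`, whose inner product is `-i c k`. -/
theorem sum_normSq_div_add_normSq_le {n L : ℕ}
    {v w : Fin L → (Fin n → ℂ)} {u : Fin n → ℂ} {c : Fin L → ℝ}
    (hc : ∀ k, 0 ≤ c k)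
    (hvv : ∀ k l, star (v k) ⬝ᵥ v l = if k = l then 1 else 0)
    (hww : ∀ k l, star (w k) ⬝ᵥ w l = if k = l then 1 else 0)
    (hvw : ∀ k l, star (v k) ⬝ᵥ w l = if k = l then -(Complex.I * (c k : ℂ)) else 0)
    (huu : star u ⬝ᵥ u = 1)
    (huv : ∀ k, star u ⬝ᵥ v k = 0)
    (huw : ∀ k, star u ⬝ᵥ w k = 0) (x : Fin n → ℂ) :
    ∑ k, (Complex.normSq (star (v k) ⬝ᵥ x) + Complex.normSq (star (w k) ⬝ᵥ x)) / (1 + c k)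
      + Complex.normSq (star u ⬝ᵥ x) ≤ ∑ i, Complex.normSq (x i) := by
  have hwv : ∀ k l, star (w k) ⬝ᵥ v l = if k = l then Complex.I * (c k : ℂ) else 0 := by
    intro k l
    rw [← star_star (star (w k) ⬝ᵥ v l), star_dotProduct, star_star, hvw]
    by_cases h : k = l
    · subst h; simp
    · simp [h, Ne.symm h]
  have hvu : ∀ k, star (v k) ⬝ᵥ u = 0 := fun k => by
    rw [← star_star (star (v k) ⬝ᵥ u), star_dotProduct, star_star, huv, star_zero]
  have hwu : ∀ k, star (w k) ⬝ᵥ u = 0 := fun k => by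
    rw [← star_star (star (w k) ⬝ᵥ u), star_dotProduct, star_star, huw, star_zero]
  set a := fun k => star (v k) ⬝ᵥ x with ha
  set b := fun k => star (w k) ⬝ᵥ x with hb
  set g := star u ⬝ᵥ x with hg
  set s : Fin L → ℂ := fun k => ((1 + c k)⁻¹ : ℝ) with hs
  set y := ∑ k, ((s k * a k) • v k + (s k * b k) • w k) + g • u with hy
  have hvy : ∀ l, star (v l) ⬝ᵥ y = s l * (a l - Complex.I * c l * b l) := fun l => by
    simp [hy, dotProduct_add, dotProduct_sum, dotProduct_smul, hvv, hvw, hvu,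
      Finset.sum_add_distrib]
    ring
  have hwy : ∀ l, star (w l) ⬝ᵥ y = s l * (b l + Complex.I * c l * a l) := fun l => by
    simp [hy, dotProduct_add, dotProduct_sum, dotProduct_smul, hww, hwv, hwu,
      Finset.sum_add_distrib]
    ring
  have huy : star u ⬝ᵥ y = g := by
    simp [hy, dotProduct_add, dotProduct_sum, dotProduct_smul, huv, huw, huu]
  have hss : ∀ k, star (s k) = s k := fun k => Complex.conj_ofReal _
  have hyz : ∀ z, star y ⬝ᵥ z = ∑ k, s k * (star (a k) * (star (v k) ⬝ᵥ z)
      + star (b k) * (star (w k) ⬝ᵥ z)) + star g * (star u ⬝ᵥ z) := fun z => by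
    simp only [hy, star_add, star_sum, star_smul, star_mul', hss, add_dotProduct, sum_dotProduct,
      smul_dotProduct, smul_eq_mul]
    congr 1
    exact Finset.sum_congr rfl fun k _ => by ring
  have hsq : ∀ z : Fin n → ℂ, (star z ⬝ᵥ z).re = ∑ i, Complex.normSq (z i) := fun z => by
    simp [dotProduct, Complex.normSq_apply]
  have hxy : (star x ⬝ᵥ y).re = (star y ⬝ᵥ x).re := by
    rw [← star_star (star x ⬝ᵥ y), star_dotProduct, star_star]; rfl
  have hyx : (star y ⬝ᵥ x).re = ∑ k, (Complex.normSq (a k) + Complex.normSq (b k)) / (1 + c k)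
      + Complex.normSq g := by
    rw [hyz, Complex.add_re, Complex.re_sum]
    congr 1
    · refine Finset.sum_congr rfl fun k _ => ?_
      rw [hs, Complex.re_ofReal_mul, div_eq_inv_mul]
      simp [Complex.normSq_apply, ha, hb]
    · simp [Complex.normSq_apply, hg]
  have hyy : (star y ⬝ᵥ y).re ≤ (star y ⬝ᵥ x).re := by
    rw [hyx, hyz, Complex.add_re, Complex.re_sum]
    refine add_le_add (Finset.sum_le_sum fun k _ => ?_) (le_of_eq ?_)
    · have hp : 0 < 1 + c k := by linarith [hc k]
      have e : (star (a k) * (star (v k) ⬝ᵥ y) + star (b k) * (star (w k) ⬝ᵥ y)).re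
          = (1 + c k)⁻¹ * (Complex.normSq (a k) + Complex.normSq (b k)
            + 2 * c k * ((a k).re * (b k).im - (a k).im * (b k).re)) := by
        rw [hvy, hwy, mul_left_comm, mul_left_comm (star (b k)), ← mul_add, hs,
          Complex.re_ofReal_mul]
        congr 1
        simp [Complex.normSq_apply]
        ring
      rw [hs, Complex.re_ofReal_mul, e, div_eq_inv_mul]
      refine mul_le_mul_of_nonneg_left ?_ (inv_nonneg.mpr hp.le)
      rw [inv_mul_le_iff₀ hp, Complex.normSq_apply, Complex.normSq_apply]
      nlinarith [mul_nonneg (hc k) (add_nonneg (sq_nonneg ((a k).re - (b k).im))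
        (sq_nonneg ((a k).im + (b k).re)))]
    · rw [huy]
      simp [Complex.normSq_apply]
  have hdiff : 0 ≤ (star (x - y) ⬝ᵥ (x - y)).re := by
    rw [hsq]
    exact Finset.sum_nonneg fun i _ => Complex.normSq_nonneg _
  rw [star_sub, sub_dotProduct, dotProduct_sub, dotProduct_sub] at hdiff
  simp only [Complex.sub_re] at hdiff
  rw [← hsq, ← hyx]
  linarith

/-- lower bound of Theorem 3, odd case `N_p = 2L+1`. Given the
decomposition family `v_1, w_1, …, v_L, w_L` together with an extra unit vector `v_{L+1}`
ℂ-orthogonal to all of them, arranged as the columns of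
`V = (v_1, w_1, …, v_L, w_L, v_{L+1})`, every observation matrix `M` with `Tr(MMᴴ) = P`
and `Re(Vᴴ M Mᴴ V)` invertible satisfies
`Tr[(Re(Vᴴ M Mᴴ V))⁻¹] ≥ (4/P)·(Σ_k 1/√(1+c_k) + 1/2)²`. -/
theorem crb_lower_bound_odd {n L m : ℕ} (hn : 0 < n) (hL : 0 < L)
    (v w : Fin L → (Fin n → ℂ)) (u : Fin n → ℂ) (c : Fin L → ℝ)
    (hc : ∀ k, 0 ≤ c k ∧ c k ≤ 1)
    (hvv : ∀ k l, star (v k) ⬝ᵥ v l = if k = l then 1 else 0)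
    (hww : ∀ k l, star (w k) ⬝ᵥ w l = if k = l then 1 else 0)
    (hvw : ∀ k l, star (v k) ⬝ᵥ w l = if k = l then -(Complex.I * (c k : ℂ)) else 0)
    (huu : star u ⬝ᵥ u = 1)
    (huv : ∀ k, star u ⬝ᵥ v k = 0)
    (huw : ∀ k, star u ⬝ᵥ w k = 0)
    (V : Matrix (Fin n) (Fin (2 * L + 1)) ℂ)
    (hV : V = Matrix.of fun (i : Fin n) (j : Fin (2 * L + 1)) =>
      if h : (j : ℕ) = 2 * L then u i
      else if (j : ℕ) % 2 = 0 then v ⟨(j : ℕ) / 2, by have := j.isLt; omega⟩ i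
      else w ⟨(j : ℕ) / 2, by have := j.isLt; omega⟩ i)
    (P : ℝ) (hP : 0 < P)
    (M : Matrix (Fin n) (Fin m) ℂ)
    (hpow : (M * Mᴴ).trace = (P : ℂ))
    (hinv : IsUnit ((Vᴴ * M * Mᴴ * V).map Complex.re)) :
    (4 / P) * (∑ k, 1 / Real.sqrt (1 + c k) + 1 / 2) ^ 2 ≤
      (((Vᴴ * M * Mᴴ * V).map Complex.re)⁻¹).trace := by
  classical
  set N := Mᴴ * V with hN
  have hJ : Vᴴ * M * Mᴴ * V = Nᴴ * N := by
    simp [hN, Matrix.mul_assoc]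
  rw [hJ] at hinv ⊢
  set J := (Nᴴ * N).map Complex.re with hJdef
  set S := ∑ k, 1 / Real.sqrt (1 + c k) + 1 / 2 with hS
  let t : ℝ := 2 * S / P
  let d : Fin (2 * L + 1) → ℝ := fun j =>
    if h : (j : ℕ) = 2 * L then t
    else t / Real.sqrt (1 + c ⟨(j : ℕ) / 2, by have := j.isLt; omega⟩)
  have hdlast : d ⟨2 * L, by omega⟩ = t := by simp [d]
  have hdeven : ∀ k : Fin L, d ⟨2 * k, by omega⟩ = t / Real.sqrt (1 + c k) := fun k => by
    have h : 2 * (k : ℕ) ≠ 2 * L := by omega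
    simp [d, h]
  have hdodd : ∀ k : Fin L, d ⟨2 * k + 1, by omega⟩ = t / Real.sqrt (1 + c k) := fun k => by
    have h : 2 * (k : ℕ) + 1 ≠ 2 * L := by omega
    have h' : (2 * (k : ℕ) + 1) / 2 = k := by omega
    simp [d, h, h']
  have hVlast : (fun i => V i ⟨2 * L, by omega⟩) = u := by
    funext i; simp [hV]
  have hVeven : ∀ k : Fin L, (fun i => V i ⟨2 * k, by omega⟩) = v k := fun k => by
    have h : (k : ℕ) ≠ L := by omega
    funext i; simp [hV, h]
  have hVodd : ∀ k : Fin L, (fun i => V i ⟨2 * k + 1, by omega⟩) = w k := fun k => by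
    have h : 2 * (k : ℕ) + 1 ≠ 2 * L := by omega
    have h' : (2 * (k : ℕ) + 1) / 2 = k := by omega
    have h'' : (2 * (k : ℕ) + 1) % 2 = 1 := by omega
    funext i; simp [hV, h, h', h'']
  have hNsq : ∀ r j, Complex.normSq (N r j)
      = Complex.normSq (star (fun i => V i j) ⬝ᵥ fun i => M i r) := fun r j => by
    rw [← Complex.normSq_conj]
    congr 1
    simp [hN, Matrix.mul_apply, dotProduct, mul_comm]
  have hJdiag : ∀ j, J j j = ∑ r, Complex.normSq (N r j) := fun j => by
    simp [hJdef, Matrix.mul_apply, Complex.normSq_apply]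
  have hPsum : ∑ r, ∑ i, Complex.normSq (M i r) = P := by
    rw [Finset.sum_comm]
    have h := congrArg Complex.re hpow
    simpa [Matrix.trace, Matrix.mul_apply, Complex.normSq_apply] using h
  have hsum : ∑ j, d j = 2 * t * S := by
    rw [Fin.sum_univ_pairs_add_last]
    simp only [hdlast, hdeven, hdodd]
    rw [hS, mul_add, Finset.mul_sum]
    congr 1
    · exact Finset.sum_congr rfl fun k _ => by ring
    · ring
  have hquad : ∑ j, d j ^ 2 * J j j ≤ t ^ 2 * P := by
    simp only [hJdiag, Finset.mul_sum]
    rw [Finset.sum_comm, ← hPsum, Finset.mul_sum]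
    refine Finset.sum_le_sum fun r _ => ?_
    refine le_trans (le_of_eq ?_) (mul_le_mul_of_nonneg_left
      (sum_normSq_div_add_normSq_le (fun k => (hc k).1) hvv hww hvw huu huv huw
        fun i => M i r) (sq_nonneg t))
    rw [Fin.sum_univ_pairs_add_last]
    simp only [hdlast, hdeven, hdodd, hNsq, hVlast, hVeven, hVodd]
    rw [mul_add, Finset.mul_sum]
    congr 1
    refine Finset.sum_congr rfl fun k _ => ?_
    rw [div_pow, Real.sq_sqrt (by linarith [(hc k).1])]
    ring
  have hmain := (posSemidef_map_re_conjTranspose_mul_self N).two_mul_sum_sub_le_trace_inv hinv d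
  have hval : 2 * (2 * t * S) - t ^ 2 * P = 4 / P * S ^ 2 := by
    simp only [t]
    field_simp
    ring
  rw [hsum] at hmain
  linarith
end

section
/- Let N ≥ 1 and P > 0. (a) For every M ∈ ℂ^{N×m} with Tr(MMᴴ) = P such that MMᴴ is invertible, one has Tr[ (MMᴴ)⁻¹ ] ≥ N²/P. (b) If B ∈ ℂ^{N×N} is unitary and M = √(P/N)·B, then Tr(MMᴴ) = P and Tr[ (MMᴴ)⁻¹ ] = N²/P. -/
open Matrix

open scoped ComplexOrder

/-- Expanding `0 ≤ Tr[(cA - 1) A⁻¹ (cA - 1)]` for a positive semidefinite invertible `A`. -/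
theorem Matrix.PosSemidef.two_mul_card_sub_le_trace_inv {n 𝕜 : Type*} [Fintype n]
    [DecidableEq n] [RCLike 𝕜] {A : Matrix n n 𝕜} (hA : A.PosSemidef) (hu : IsUnit A) (c : ℝ) :
    2 * (c : 𝕜) * Fintype.card n - (c : 𝕜) ^ 2 * A.trace ≤ A⁻¹.trace := by
  have hdet : IsUnit A.det := (Matrix.isUnit_iff_isUnit_det A).1 hu
  have hH : ((c : 𝕜) • A - 1)ᴴ = (c : 𝕜) • A - 1 := by
    simp [conjTranspose_smul, hA.isHermitian.eq]
  have h := (hA.inv.mul_mul_conjTranspose_same ((c : 𝕜) • A - 1)).trace_nonneg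
  have hexp : ((c : 𝕜) • A - 1) * A⁻¹ * ((c : 𝕜) • A - 1) =
      (c : 𝕜) ^ 2 • A - (2 * (c : 𝕜)) • (1 : Matrix n n 𝕜) + A⁻¹ := by
    simp only [sub_mul, mul_sub, smul_mul_assoc, mul_smul_comm, one_mul, mul_one,
      Matrix.mul_nonsing_inv A hdet, Matrix.nonsing_inv_mul A hdet]
    module
  rw [hH, hexp, trace_add, trace_sub, trace_smul, trace_smul, trace_one, smul_eq_mul,
    smul_eq_mul] at h
  rw [← sub_nonneg]
  convert h using 1
  ring

/-- least-squares model, equations (27)–(28) of the paper.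
(a) Every `M ∈ ℂ^{N×m}` with `Tr(MMᴴ) = P` and `MMᴴ` invertible satisfies
`Tr[(MMᴴ)⁻¹] ≥ N²/P` (the trace being a real number). (b) If `B ∈ ℂ^{N×N}` is unitary
and `M = √(P/N)·B`, then `Tr(MMᴴ) = P` and `Tr[(MMᴴ)⁻¹] = N²/P`. -/
theorem least_squares_optimal_crb {N : ℕ} (hN : 1 ≤ N) (P : ℝ) (hP : 0 < P) :
    (∀ (m : ℕ) (M : Matrix (Fin N) (Fin m) ℂ),
      (M * Mᴴ).trace = (P : ℂ) → IsUnit (M * Mᴴ) →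
      ∃ t : ℝ, ((M * Mᴴ)⁻¹).trace = (t : ℂ) ∧ (N : ℝ) ^ 2 / P ≤ t) ∧
    (∀ (B : Matrix (Fin N) (Fin N) ℂ) (M : Matrix (Fin N) (Fin N) ℂ),
      Bᴴ * B = 1 → M = ((Real.sqrt (P / N) : ℝ) : ℂ) • B →
      (M * Mᴴ).trace = (P : ℂ) ∧
      ((M * Mᴴ)⁻¹).trace = (((N : ℝ) ^ 2 / P : ℝ) : ℂ)) := by
  have hN0 : (N : ℂ) ≠ 0 := by exact_mod_cast (by omega : N ≠ 0)
  have hP0 : (P : ℂ) ≠ 0 := by exact_mod_cast hP.ne'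
  refine ⟨fun m M htr hu => ?_, fun B M hB hM => ?_⟩
  · have h := (posSemidef_self_mul_conjTranspose M).two_mul_card_sub_le_trace_inv hu (N / P)
    have hval : 2 * ((N / P : ℝ) : ℂ) * N - ((N / P : ℝ) : ℂ) ^ 2 * P =
        (((N : ℝ) ^ 2 / P : ℝ) : ℂ) := by
      push_cast
      field_simp
      ring
    rw [htr, Fintype.card_fin] at h
    replace h := hval.symm.trans_le h
    obtain ⟨hre, him⟩ := Complex.le_def.1 h
    rw [Complex.ofReal_re] at hre
    rw [Complex.ofReal_im] at him
    exact ⟨_, Complex.ext rfl (by rw [← him, Complex.ofReal_im]), hre⟩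
  · have hMM : M * Mᴴ = ((P : ℂ) / N) • (1 : Matrix (Fin N) (Fin N) ℂ) := by
      rw [hM, conjTranspose_smul, smul_mul_smul_comm, mul_eq_one_comm.1 hB, Complex.star_def,
        Complex.conj_ofReal, ← Complex.ofReal_mul, Real.mul_self_sqrt (by positivity)]
      push_cast
      rfl
    have hinv : (M * Mᴴ)⁻¹ = ((N : ℂ) / P) • (1 : Matrix (Fin N) (Fin N) ℂ) := by
      refine inv_eq_right_inv ?_
      rw [hMM, smul_mul_smul_comm, one_mul, div_mul_div_cancel₀ hN0, div_self hP0, one_smul]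
    rw [hinv, hMM]
    simp only [trace_smul, trace_one, Fintype.card_fin, smul_eq_mul]
    push_cast
    constructor <;> field_simp
end
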